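/- arXiv:1912.00814 — 3 statements merged into one kernel-verified Lean document; each statement's English description precedes it below -/
import Mathlib

section
/- Every strongly connected tournament D on n vertices either has a universal line (a line equal to the entire vertex set) or has at least n distinct lines. -/
open scoped Classical

/-- `stepsTo A n u v` : there is a directed walk of length `n` from `u` to `v`
in the digraph with arc relation `A`. -/
def stepsTo {V : Type*} (A : V → V → Prop) : ℕ → V → V → Prop
  | 0, u, v => u = v
  | n+1, u, v => ∃ w, A u w ∧ stepsTo A n w v

/-- A digraph is strongly connected if every vertex is reachable from every vertex. -/
def StronglyConnected {V : Type*} (A : V → V → Prop) : Prop :=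
  ∀ u v : V, ∃ n : ℕ, stepsTo A n u v

/-- The directed distance: the length of a shortest directed path from `u` to `v`. -/
noncomputable def ddist {V : Type*} (A : V → V → Prop) (u v : V) : ℕ :=
  sInf {n : ℕ | stepsTo A n u v}

/-- `btw A u v z` means `z ∈ [u,v]`, i.e. `z` lies on a shortest dipath from `u` to `v`. -/
def btw {V : Type*} (A : V → V → Prop) (u v z : V) : Prop :=
  ddist A u v = ddist A u z + ddist A z v

/-- The line generated by the ordered pair `(u,v)`:
`{z : u ∈ [z,v] or v ∈ [u,z] or z ∈ [u,v]}`. -/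
def line {V : Type*} (A : V → V → Prop) (u v : V) : Set V :=
  {z | btw A z v u ∨ btw A u z v ∨ btw A u v z}

/-- `L(D)`: the set of all lines generated by ordered pairs of distinct vertices. -/
def lineSet {V : Type*} (A : V → V → Prop) : Set (Set V) :=
  {S | ∃ u v : V, u ≠ v ∧ S = line A u v}

/-- Abstract properties of the distance function of a strong tournament. -/
structure TD {V : Type*} (d : V → V → ℕ) : Prop where
  zero : ∀ p q, d p q = 0 ↔ p = q
  tri : ∀ p q r, d p r ≤ d p q + d q r
  tour : ∀ p q, (d p q = 0 ∧ d q p = 0) ∨ (d p q = 1 ∧ 2 ≤ d q p) ∨ (d q p = 1 ∧ 2 ≤ d p q)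
  first : ∀ p q, p ≠ q → ∃ w, d p w = 1 ∧ d p q = d w q + 1
  last : ∀ p q, p ≠ q → ∃ w, d w q = 1 ∧ d p q = d p w + 1

/-- The arc `p → q` generates the line `L`. -/
def Cl {V : Type*} (d : V → V → ℕ) (L : Set V) (p q : V) : Prop :=
  d p q = 1 ∧ ∀ z, z ∈ L ↔ (d z q = d z p + 1 ∨ d p z = d q z + 1)

namespace TD
variable {V : Type*} {d : V → V → ℕ} {L : Set V}

theorem self (h : TD d) (p : V) : d p p = 0 := (h.zero p p).2 rfl

theorem flip (h : TD d) : TD (fun a b => d b a) where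
  zero p q := by rw [h.zero q p]; exact eq_comm
  tri p q r := by have := h.tri r q p; omega
  tour p q := by have := h.tour p q; omega
  first p q hpq := h.last q p (Ne.symm hpq)
  last p q hpq := h.first q p (Ne.symm hpq)

theorem clflip {p q : V} (hc : Cl d L p q) : Cl (fun a b => d b a) L q p :=
  ⟨hc.1, fun z => by rw [hc.2 z]; exact or_comm⟩

theorem nm (h : TD d) {p q z : V} (hc : Cl d L p q) (hz : z ∉ L) :
    d z q ≤ d z p ∧ d p z ≤ d q z := by
  rw [hc.2 z] at hz
  have := h.tri z p q
  have := h.tri p q z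
  have := hc.1
  omega

theorem left_mem (h : TD d) {p q : V} (hc : Cl d L p q) : p ∈ L := by
  rw [hc.2]; left; rw [h.self, hc.1]

theorem right_mem (h : TD d) {p q : V} (hc : Cl d L p q) : q ∈ L := by
  rw [hc.2]; right; rw [h.self, hc.1]

theorem tail_inj (h : TD d) {x v v' : V} (h1 : Cl d L x v) (h2 : Cl d L x v') : v = v' := by
  rw [← h.zero]
  have a := (h1.2 v').1 (h.right_mem h2)
  have b := (h2.2 v).1 (h.right_mem h1)
  have := h1.1
  have := h2.1
  have := h.tour v v'
  have := h.tour x v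
  have := h.tour x v'
  omega

theorem head_inj (h : TD d) {x v v' : V} (h1 : Cl d L v x) (h2 : Cl d L v' x) : v = v' :=
  h.flip.tail_inj (clflip h1) (clflip h2)

theorem back (h : TD d) {u x v : V} (h1 : Cl d L u x) (h2 : Cl d L x v) :
    d v u = 1 ∧ d u v = 2 := by
  have e1 := h1.1
  have e2 := h2.1
  have t1 := h.tri u x v
  have t2 := h.tour u v
  have t3 := h.tour u x
  have t4 := h.tour x v
  by_cases huv : d u v = 1
  · exfalso
    have a := (h1.2 v).1 (h.right_mem h2)
    have b := (h2.2 u).1 (h.left_mem h1)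
    have hne : v ≠ u := by
      intro e; rw [← h.zero] at e; omega
    obtain ⟨w, hw1, hw2⟩ := h.last v u hne
    have := h.tour x w
    have := h.tri x w u
    have := h.tri v w x
    by_cases hxw : x = w
    · subst hxw; omega
    · rw [← h.zero] at hxw
      omega
  · by_cases h0 : d u v = 0
    · rw [h.zero] at h0; subst h0; omega
    · omega

theorem FB (h : TD d) {u x v : V} (h1 : Cl d L u x) (h2 : Cl d L x v) {z : V} (hz : z ∈ L) :
    z = x ∨ (d u z = 2 + d v z ∧ d x z = 1 + d v z) ∨ (d z v = 2 + d z u ∧ d z x = 1 + d z u) := by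
  obtain ⟨b1, b2⟩ := h.back h1 h2
  have e1 := h1.1
  have e2 := h2.1
  have a := (h1.2 z).1 hz
  have b := (h2.2 z).1 hz
  have t1 := h.tour z u
  have t2 := h.tour z x
  have t3 := h.tour z v
  have := h.tri z u x
  have := h.tri x v z
  have e : d z x = 0 ↔ z = x := h.zero z x
  by_cases hzx : z = x
  · exact Or.inl hzx
  by_cases hzu : z = u
  · subst hzu; have := h.self z; omega
  by_cases hzv : z = v
  · subst hzv; have := h.self z; omega
  · right
    have z1 : d z u ≠ 0 := fun H => hzu ((h.zero z u).1 H)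
    have z2 : d z v ≠ 0 := fun H => hzv ((h.zero z v).1 H)
    have z3 : d z x ≠ 0 := fun H => hzx (e.1 H)
    have := h.tri u x z
    have := h.tri z x v
    omega

/-- `a → b` is a further arc of the class: possible types. -/
theorem types (h : TD d) {u x v a b : V} (h1 : Cl d L u x) (h2 : Cl d L x v) (hc : Cl d L a b)
    (hau : a ≠ u) (hax : a ≠ x) (hbx : b ≠ x) (hbv : b ≠ v) :
    (a = v ∧ b = u) ∨
    ((d u a = 2 + d v a ∧ d x a = 1 + d v a) ∧ (d u b = 2 + d v b ∧ d x b = 1 + d v b) ∧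
      d v b = d v a + 1) ∨
    ((d a v = 2 + d a u ∧ d a x = 1 + d a u) ∧ (d b v = 2 + d b u ∧ d b x = 1 + d b u) ∧
      d a u = d b u + 1) ∨
    ((d a v = 2 + d a u ∧ d a x = 1 + d a u) ∧ (d u b = 2 + d v b ∧ d x b = 1 + d v b) ∧
      1 ≤ d a u ∧ 1 ≤ d v b) := by
  obtain ⟨b1, b2⟩ := h.back h1 h2
  have e1 := h1.1
  have e2 := h2.1
  have e3 := hc.1
  have Ta := (h.FB h1 h2 (h.left_mem hc)).resolve_left hax
  have Tb := (h.FB h1 h2 (h.right_mem hc)).resolve_left hbx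
  have mu := (hc.2 u).1 (h.left_mem h1)
  have mv := (hc.2 v).1 (h.right_mem h2)
  have ne1 : d a u ≠ 0 := fun e => hau ((h.zero _ _).1 e)
  have ne2 : d b v ≠ 0 := fun e => hbv ((h.zero _ _).1 e)
  have ne3 : d a x ≠ 0 := fun e => hax ((h.zero _ _).1 e)
  have ne4 : d b x ≠ 0 := fun e => hbx ((h.zero _ _).1 e)
  have ta := h.tour a u
  have tb := h.tour b u
  have ta' := h.tour a v
  have tb' := h.tour b v
  have ta2 := h.tour a x
  have tb2 := h.tour b x
  have r1 := h.tri u x b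
  have r2 := h.tri a x v
  rcases Ta with Ta | Ta <;> rcases Tb with Tb | Tb
  · right; left; omega
  · left
    rw [← h.zero, ← h.zero]
    omega
  · right; right; right; omega
  · right; right; left; omega

/-- No outsider sits in the middle position once there is a further arc. -/
theorem nomid (h : TD d) {u x v a b y : V} (h1 : Cl d L u x) (h2 : Cl d L x v) (hc : Cl d L a b)
    (hau : a ≠ u) (hax : a ≠ x) (hbx : b ≠ x) (hbv : b ≠ v) (hy : y ∉ L) :
    (d y u = 1 ∧ d y x = 1 ∧ d y v = 1) ∨ (d u y = 1 ∧ d x y = 1 ∧ d v y = 1) := by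
  obtain ⟨b1, b2⟩ := h.back h1 h2
  have n1 := h.nm h1 hy
  have n2 := h.nm h2 hy
  have n3 := h.nm hc hy
  have e3 := hc.1
  have tu := h.tour y u
  have tx := h.tour y x
  have tv := h.tour y v
  have ne : ∀ z ∈ L, d y z ≠ 0 := fun z hz e => hy ((h.zero _ _).1 e ▸ hz)
  have ne1 := ne u (h.left_mem h1)
  have ne2 := ne x (h.left_mem h2)
  have ne3 := ne v (h.right_mem h2)
  have ne4 := ne a (h.left_mem hc)
  have ne5 := ne b (h.right_mem hc)
  by_contra hcon
  have m1 : d u y = 1 := by omega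
  have m2 : d y v = 1 := by omega
  rcases h.types h1 h2 hc hau hax hbx hbv with ⟨rfl, rfl⟩ | T | T | T
  · omega
  · have := h.tri y v a
    have := h.tri u y b
    omega
  · have := h.tri b u y
    have := h.tri a y v
    omega
  · have := h.tour y a
    have := h.tour y b
    have := h.tri u y b
    have := h.tri a y v
    omega

/-- Two outsiders `w1 → w2` with `P → w1` and `w2 → P`, starting from a dominating outsider. -/
theorem exW (h : TD d) {u x v y : V} (h1 : Cl d L u x) (h2 : Cl d L x v)
    (hm : ∀ y, y ∉ L → (d y u = 1 ∧ d y x = 1 ∧ d y v = 1) ∨ (d u y = 1 ∧ d x y = 1 ∧ d v y = 1))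
    (hy : y ∉ L) (hyu : d y u = 1) :
    ∃ w1 w2, w1 ∉ L ∧ w2 ∉ L ∧ d w1 w2 = 1 ∧ (d u w1 = 1 ∧ d x w1 = 1 ∧ d v w1 = 1) ∧
      (d w2 u = 1 ∧ d w2 x = 1 ∧ d w2 v = 1) := by
  obtain ⟨b1, b2⟩ := h.back h1 h2
  have e1 := h1.1
  have e2 := h2.1
  have n1 := h.nm h1 hy
  have n2 := h.nm h2 hy
  have tu := h.tour y u
  have hne : u ≠ y := by
    intro e; rw [← h.zero] at e; omega
  obtain ⟨w1, f1, f2⟩ := h.first u y hne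
  have hne2 : w1 ≠ y := by
    intro e; subst e; omega
  obtain ⟨w2, g1, g2⟩ := h.first w1 y hne2
  have tw2u := h.tri u w2 y
  have tw2x := h.tri x w2 y
  have tw2v := h.tri v w2 y
  have tuw := h.tri u w1 w2
  have s1 := h.tour u w1
  have s2 := h.tour u w2
  have s3 := h.tour x w2
  have s4 := h.tour v w2
  have s5 := h.tour w1 w2
  have hw2 : w2 ∉ L := by
    intro hw
    rcases h.FB h1 h2 hw with rfl | T | T
    · omega
    · have := h.tri v w2 y
      have : d v w2 = 0 := by omega
      omega
    · omega
  have k2 := hm w2 hw2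
  have hw1 : w1 ∉ L := by
    intro hw
    have := h.tri w1 w2 v
    rcases h.FB h1 h2 hw with rfl | T | T
    · omega
    · omega
    · omega
  have k1 := hm w1 hw1
  exact ⟨w1, w2, hw1, hw2, g1, by omega, by omega⟩

theorem exW' (h : TD d) {u x v y : V} (h1 : Cl d L u x) (h2 : Cl d L x v)
    (hm : ∀ y, y ∉ L → (d y u = 1 ∧ d y x = 1 ∧ d y v = 1) ∨ (d u y = 1 ∧ d x y = 1 ∧ d v y = 1))
    (hy : y ∉ L) :
    ∃ w1 w2, w1 ∉ L ∧ w2 ∉ L ∧ d w1 w2 = 1 ∧ (d u w1 = 1 ∧ d x w1 = 1 ∧ d v w1 = 1) ∧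
      (d w2 u = 1 ∧ d w2 x = 1 ∧ d w2 v = 1) := by
  rcases hm y hy with k | k
  · exact h.exW h1 h2 hm hy k.1
  · obtain ⟨w2, w1, p1, p2, p3, p4, p5⟩ := h.flip.exW (clflip h2) (clflip h1)
      (fun y hy => by have := hm y hy; omega) hy k.2.2
    exact ⟨w1, w2, p2, p1, p3, by omega, by omega⟩

/-- A further middle vertex must be an end of the first path. -/
theorem middle (h : TD d) {u x v a b c w1 w2 : V} (h1 : Cl d L u x) (h2 : Cl d L x v)
    (hw1 : w1 ∉ L) (hw2 : w2 ∉ L) (hw : d w1 w2 = 1)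
    (k1 : d u w1 = 1 ∧ d x w1 = 1 ∧ d v w1 = 1)
    (k2 : d w2 u = 1 ∧ d w2 x = 1 ∧ d w2 v = 1)
    (ha : Cl d L a b) (hb : Cl d L b c) : b = u ∨ b = x ∨ b = v := by
  by_contra hcon
  push Not at hcon
  obtain ⟨hbu, hbx, hbv⟩ := hcon
  have hau : a ≠ u := by rintro rfl; exact hbx (h.tail_inj ha h1)
  have hax : a ≠ x := by rintro rfl; exact hbv (h.tail_inj ha h2)
  have hcx : c ≠ x := by rintro rfl; exact hbu (h.head_inj hb h1)
  have hcv : c ≠ v := by rintro rfl; exact hbx (h.head_inj hb h2)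
  have A := h.types h1 h2 ha hau hax hbx hbv
  have B := h.types h1 h2 hb hbu hbx hcx hcv
  have A' := A.resolve_left (fun e => hbu e.2)
  have B' := B.resolve_left (fun e => hbv e.1)
  have q1 := h.nm ha hw1
  have q2 := h.nm hb hw1
  have q3 := h.nm ha hw2
  have q4 := h.nm hb hw2
  have t1 := h.tri u w1 w2
  have t2 := h.tri w1 w2 v
  have tb := h.tour b u
  have tb' := h.tour b v
  have ne : ∀ w, w ∉ L → ∀ z ∈ L, d w z ≠ 0 := fun w hw z hz e => hw ((h.zero _ _).1 e ▸ hz)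
  have ne1 := ne w1 hw1 c (h.right_mem hb)
  have ne2 := ne w1 hw1 a (h.left_mem ha)
  have ne3 := ne w2 hw2 c (h.right_mem hb)
  have ne4 := ne w2 hw2 a (h.left_mem ha)
  have z1 : d b u ≠ 0 := fun H => hbu ((h.zero b u).1 H)
  have z2 : d b v ≠ 0 := fun H => hbv ((h.zero b v).1 H)
  have z3 := h.tour b x
  have s1 := h.tour w1 c
  have s2 := h.tour w1 a
  have s3 := h.tour w2 c
  have s4 := h.tour w2 a
  have r1 := h.tri u w1 c
  have r2 := h.tri a w1 v
  have r3 := h.tri u w2 c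
  have r4 := h.tri a w2 v
  have r5 := h.tri w2 v a
  have r6 := h.tri c u w1
  rcases A' with A | A | A <;> rcases B' with B | B | B
  all_goals omega

theorem noboth (h : TD d) {u x v a b w1 w2 : V} (h1 : Cl d L u x) (h2 : Cl d L x v)
    (hw1 : w1 ∉ L) (hw2 : w2 ∉ L) (hw : d w1 w2 = 1)
    (k1 : d u w1 = 1 ∧ d x w1 = 1 ∧ d v w1 = 1)
    (k2 : d w2 u = 1 ∧ d w2 x = 1 ∧ d w2 v = 1)
    (ha : Cl d L a u) (hb : Cl d L v b) (hav : a ≠ v) : False := by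
  have B1 := h.back h1 h2
  have B2 := h.back ha h1
  have B3 := h.back h2 hb
  have q1 := h.nm ha hw1
  have q4 := h.nm hb hw2
  have t1 := h.tri a w1 b
  have t2 := h.tri w1 w2 b
  have e1 := h1.1
  have e2 := h2.1
  have e3 := ha.1
  have e4 := hb.1
  have m := (ha.2 b).1 (h.right_mem hb)
  have m2 := (h1.2 b).1 (h.right_mem hb)
  have o1 := h.tour a x
  have o2 := h.tour b x
  have o3 := h.tour b u
  have o4 := h.tour a v
  have o5 : d a v ≠ 0 := fun e => hav ((h.zero _ _).1 e)
  have o6 := h.tour a b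
  have o7 : d b u ≠ 0 := by
    intro e
    have := (h.zero _ _).1 e
    subst this
    exact hav (h.head_inj ha hb)
  have m3 := (h2.2 a).1 (h.left_mem ha)
  have o8 : d a b ≠ 0 := by
    intro e
    have := (h.zero _ _).1 e
    subst this
    omega
  omega

/-- Triangles: the line is exactly the triangle. -/
theorem triangle (h : TD d) {u x v z : V} (h1 : Cl d L u x) (h2 : Cl d L x v) (h3 : Cl d L v u)
    (hz : z ∈ L) : z = u ∨ z = x ∨ z = v := by
  have m := (h3.2 z).1 hz
  have e1 := h.zero z u
  have e2 := h.zero z v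
  have t1 := h.tour z u
  have t2 := h.tour z v
  rcases h.FB h1 h2 hz with rfl | T | T
  · simp
  · by_cases e : d z v = 0
    · exact Or.inr (Or.inr (e2.1 e))
    · omega
  · by_cases e : d z u = 0
    · exact Or.inl (e1.1 e)
    · omega

/-- Crossing the boundary of `S` along a geodesic. -/
theorem cross (h : TD d) (S : Set V) (n : ℕ) : ∀ p z, d p z = n → p ∈ S → z ∉ S →
    ∃ r r', r ∈ S ∧ r' ∉ S ∧ d r r' = 1 ∧ d p z = d p r + 1 + d r' z := by
  induction n with
  | zero =>
    intro p z hn hp hz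
    rw [h.zero] at hn
    subst hn
    exact absurd hp hz
  | succ n ih =>
    intro p z hn hp hz
    have hne : p ≠ z := by rintro rfl; exact hz hp
    obtain ⟨w, w1, w2⟩ := h.first p z hne
    by_cases hw : w ∈ S
    · obtain ⟨r, r', a1, a2, a3, a4⟩ := ih w z (by omega) hw hz
      refine ⟨r, r', a1, a2, a3, ?_⟩
      have := h.tri p w r
      have := h.tri p r z
      have := h.tri r r' z
      omega
    · exact ⟨p, w, hp, hw, w1, by rw [h.self]; omega⟩

/-- A 4-vertex path with exactly two outsiders forces a universal line. -/
theorem univ4 (h : TD d) {p0 p1 p2 p3 w1 w2 : V} (h1 : Cl d L p0 p1) (h2 : Cl d L p1 p2)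
    (h3 : Cl d L p2 p3) (hp : p3 ≠ p0)
    (hw1 : w1 ∉ L) (hw2 : w2 ∉ L) (hw : d w1 w2 = 1)
    (k1 : d p0 w1 = 1 ∧ d p1 w1 = 1 ∧ d p2 w1 = 1)
    (k2 : d w2 p0 = 1 ∧ d w2 p1 = 1 ∧ d w2 p2 = 1)
    (hL : ∀ z, z ∉ L → z = w1 ∨ z = w2) (z : V) :
    d z w2 = d z w1 + 1 ∨ d w1 z = d w2 z + 1 := by
  have B1 := h.back h1 h2
  have B2 := h.back h2 h3
  have e1 := h1.1
  have e2 := h2.1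
  have e3 := h3.1
  have ne : ∀ w, w ∉ L → ∀ z ∈ L, d w z ≠ 0 := fun w hw z hz e => hw ((h.zero _ _).1 e ▸ hz)
  have tw := h.tour w1 w2
  have tw1 := h.tri p0 w1 w2
  have tw2 := h.tri w1 w2 p2
  have p3a : d p3 w1 = 1 ∧ d w2 p3 = 1 := by
    have q := h.nm h3 hw2
    have m := (h1.2 p3).1 (h.right_mem h3)
    have := h.tri p0 w1 p3
    have := h.tour w1 p3
    have := ne w1 hw1 p3 (h.right_mem h3)
    have := ne w2 hw2 p3 (h.right_mem h3)
    have := h.tour p3 p0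
    have : d p3 p0 ≠ 0 := fun e => hp ((h.zero _ _).1 e)
    omega
  -- every vertex of L
  have key : ∀ z ∈ L, (d z w1 = 1 ∧ d w2 z = 1) ∨
      ((d z w1 = 1 ∧ d z w2 = 1) ∧ d z p2 = 1) ∨
      ((d w1 z = 1 ∧ d w2 z = 1) ∧ 4 ≤ d z p3) := by
    intro z hz
    have n1 := ne w1 hw1 z hz
    have n2 := ne w2 hw2 z hz
    have o1 := h.tour w1 z
    have o2 := h.tour w2 z
    have o3 := h.tour z p2
    have o4 := h.tour z p1
    have r1 := h.tri p0 w1 z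
    have r2 := h.tri p1 w1 z
    have r3 := h.tri z w2 p2
    have r4 := h.tri z w2 p3
    have z0 := h.zero z p0
    have z3 := h.zero z p3
    have z2 := h.zero z p2
    rcases h.FB h1 h2 hz with rfl | T | T
    · left; omega
    · rcases h.FB h2 h3 hz with rfl | T' | T'
      · left; omega
      · by_cases ez : z = p3
        · subst ez; left; omega
        · have : d z p3 ≠ 0 := fun e => ez (z3.1 e)
          have := h.tour z p3
          by_cases ez2 : z = p2
          · subst ez2; left; omega
          have : d z p2 ≠ 0 := fun e => ez2 (z2.1 e)
          omega
      · by_cases ez2 : z = p2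
        · subst ez2; left; omega
        have : d z p2 ≠ 0 := fun e => ez2 (z2.1 e)
        omega
    · rcases h.FB h2 h3 hz with rfl | T' | T'
      · left; omega
      · by_cases ez : z = p3
        · subst ez; left; omega
        have : d z p3 ≠ 0 := fun e => ez (z3.1 e)
        have := h.tour z p3
        omega
      · by_cases ez : z = p0
        · subst ez; left; omega
        have : d z p0 ≠ 0 := fun e => ez (z0.1 e)
        omega
  by_cases hz : z ∈ L
  · have kz := key z hz
    rcases kz with kz | kz | kz
    · left
      have := h.tour z w2
      have := h.tri z w1 w2
      omega
    · right
      have s1 := h.tour z w1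
      have s2 := h.tour z w2
      obtain ⟨r, r', a1, a2, a3, a4⟩ := h.cross {t | ¬ (d t w1 = 1 ∧ d t w2 = 1)} _ w1 z rfl
        (by intro hh; have := h.self w1; omega) (by simp [kz])
      simp only [Set.mem_ofPred_eq, not_not] at a1 a2
      have s3 := h.tri w2 r z
      have s4 := h.tri r r' z
      have s5 := h.tri w1 w2 z
      by_cases hr : r ∈ L
      · have kr := key r hr
        have s6 := h.tour r w1
        rcases kr with kr | kr | kr
        · omega
        · omega
        · exfalso
          have hr' : r' ∈ L := by
            by_contra hn
            rcases hL r' hn with rfl | rfl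
            · have := h.self r'; omega
            · have := h.self r'; omega
          have kr' := key r' hr'
          have := h.tri r r' p2
          have := h.tri r p2 p3
          have := h.tour r' w1
          have := h.tour r' w2
          omega
      · have := h.tour r' w1
        have := h.tour r' w2
        rcases hL r hr with rfl | rfl <;> omega
    · left
      have s1 := h.tour z w1
      have s2 := h.tour z w2
      obtain ⟨r', r, a1, a2, a3, a4⟩ := h.cross {t | (d w1 t = 1 ∧ d w2 t = 1)} _ z w2 rfl
        (by simp [kz]) (by intro hh; have := h.self w2; simp only [Set.mem_ofPred_eq] at hh; omega)
      simp only [Set.mem_ofPred_eq] at a1 a2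
      have s3 := h.tri z r w1
      have s4 := h.tri z r' r
      have s5 := h.tri z w1 w2
      have s7 := h.tour r' w1
      have s8 := h.tour r' w2
      by_cases hr : r ∈ L
      · have kr := key r hr
        have s6 := h.tour r w2
        rcases kr with kr | kr | kr
        · omega
        · exfalso
          have hr' : r' ∈ L := by
            by_contra hn
            rcases hL r' hn with rfl | rfl
            · have := h.self r'; omega
            · have := h.self r'; omega
          have kr' := key r' hr'
          have := h.tri r' r p2
          have := h.tri r' p2 p3
          omega
        · omega
      · rcases hL r hr with rfl | rfl <;> omega
  · rcases hL z hz with rfl | rfl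
    · left; rw [h.self, hw]
    · right; rw [h.self, hw]

end TD

namespace TD
variable {V : Type*} {d : V → V → ℕ} {L : Set V}

theorem ne_of (h : TD d) {p q : V} (e : d p q ≠ 0) : p ≠ q := fun k => e ((h.zero _ _).2 k)

theorem indeg [Nontrivial V] (h : TD d)
    (hu : ∀ p q, d p q = 1 → ∃ z, ¬ (d z q = d z p + 1 ∨ d p z = d q z + 1)) (y w : V) :
    ∃ s, s ≠ w ∧ d s y = 1 := by
  by_contra hcon
  push Not at hcon
  have H : ∀ s, d s y = 1 → s = w := fun s hs => by
    by_contra hne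
    exact hcon s hne hs
  obtain ⟨z, hz⟩ := exists_ne y
  obtain ⟨s, s1, -⟩ := h.last z y hz
  have := H s s1
  subst this
  obtain ⟨t, ht⟩ := hu s y s1
  apply ht
  by_cases hty : t = y
  · subst hty; right; rw [h.self, s1]
  · obtain ⟨r, r1, r2⟩ := h.last t y hty
    have := H r r1
    subst this
    exact Or.inl r2

theorem outdeg [Nontrivial V] (h : TD d)
    (hu : ∀ p q, d p q = 1 → ∃ z, ¬ (d z q = d z p + 1 ∨ d p z = d q z + 1)) (y w : V) :
    ∃ s, s ≠ w ∧ d y s = 1 :=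
  h.flip.indeg (fun p q hpq => by
    obtain ⟨z, hz⟩ := hu q p hpq
    exact ⟨z, fun k => hz k.symm⟩) y w

theorem five [Fintype V] [Nontrivial V] (h : TD d)
    (hu : ∀ p q, d p q = 1 → ∃ z, ¬ (d z q = d z p + 1 ∨ d p z = d q z + 1)) :
    5 ≤ Fintype.card V := by
  obtain ⟨y, -⟩ := exists_pair_ne V
  obtain ⟨s, -, s1⟩ := h.indeg hu y y
  obtain ⟨s', s2, s3⟩ := h.indeg hu y s
  obtain ⟨t, -, t1⟩ := h.outdeg hu y y
  obtain ⟨t', t2, t3⟩ := h.outdeg hu y t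
  have a1 := h.tour y s
  have a2 := h.tour y s'
  have a3 := h.tour y t
  have a4 := h.tour y t'
  have : ({y, s, s', t, t'} : Finset V).card = 5 := by
    have b1 : y ≠ s := h.ne_of (by omega)
    have b2 : y ≠ s' := h.ne_of (by omega)
    have b3 : y ≠ t := h.ne_of (by omega)
    have b4 : y ≠ t' := h.ne_of (by omega)
    have b5 : s ≠ t := by rintro rfl; omega
    have b6 : s ≠ t' := by rintro rfl; omega
    have b7 : s' ≠ t := by rintro rfl; omega
    have b8 : s' ≠ t' := by rintro rfl; omega
    have b9 := s2.symm
    have b10 := t2.symm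
    simp [*]
  rw [← this]
  exact Finset.card_le_univ _

theorem count [Fintype V] (h : TD d) (C : Finset (V × V))
    (hC : ∀ p, p ∈ C ↔ Cl d L p.1 p.2) (M O : Finset V)
    (hM : ∀ a b c, Cl d L a b → Cl d L b c → b ∈ M) (hO : ∀ o ∈ O, o ∉ L)
    (hMO : M.card + 1 ≤ O.card) : 2 * C.card ≤ Fintype.card V - 1 := by
  have hT : (C.image Prod.fst).card = C.card := by
    apply Finset.card_image_of_injOn
    rintro ⟨a, b⟩ hp ⟨a', b'⟩ hq (e : a = a')
    subst e
    have this : b = b' := h.tail_inj ((hC (a, b)).1 hp) ((hC (a, b')).1 hq)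
    rw [this]
  have hH : (C.image Prod.snd).card = C.card := by
    apply Finset.card_image_of_injOn
    rintro ⟨a, b⟩ hp ⟨a', b'⟩ hq (e : b = b')
    subst e
    have this : a = a' := h.head_inj ((hC (a, b)).1 hp) ((hC (a', b)).1 hq)
    rw [this]
  have hu := Finset.card_union_add_card_inter (C.image Prod.fst) (C.image Prod.snd)
  have h1 : (C.image Prod.fst ∩ C.image Prod.snd).card ≤ M.card := by
    apply Finset.card_le_card
    intro b hb
    simp only [Finset.mem_inter, Finset.mem_image, Prod.exists, exists_and_right,
      exists_eq_right] at hb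
    obtain ⟨⟨c, hc⟩, ⟨a, ha⟩⟩ := hb
    exact hM a b c ((hC _).1 ha) ((hC _).1 hc)
  have h2 : (C.image Prod.fst ∪ C.image Prod.snd).card + O.card ≤ Fintype.card V := by
    rw [← Finset.card_union_of_disjoint]
    · exact Finset.card_le_univ _
    · rw [Finset.disjoint_left]
      intro z hz hzO
      apply hO z hzO
      simp only [Finset.mem_union, Finset.mem_image, Prod.exists, exists_and_right,
        exists_eq_right] at hz
      rcases hz with ⟨c, hc⟩ | ⟨c, hc⟩
      · exact h.left_mem ((hC _).1 hc)
      · exact h.right_mem ((hC _).1 hc)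
  omega

theorem four [Fintype V] (h : TD d)
    (hu : ∀ p q, d p q = 1 → ∃ z, ¬ (d z q = d z p + 1 ∨ d p z = d q z + 1))
    (C : Finset (V × V)) (hC : ∀ p, p ∈ C ↔ Cl d L p.1 p.2)
    {p0 p1 p2 p3 : V} (h1 : Cl d L p0 p1) (h2 : Cl d L p1 p2)
    (h3 : Cl d L p2 p3) (hp : p3 ≠ p0) : 2 * C.card ≤ Fintype.card V - 1 := by
  have B1 := h.back h1 h2
  have B2 := h.back h2 h3
  have e2 := h2.1
  have e3 := h3.1
  have hm := fun y (hy : y ∉ L) => h.nomid h1 h2 h3 (h.ne_of (by omega)) (h.ne_of (by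
    have := h.tour p1 p2; omega)) (h.ne_of (by omega))
    (h.ne_of (by have := h.tour p2 p3; omega)) hy
  obtain ⟨y, hy⟩ := hu p0 p1 h1.1
  rw [← h1.2 y] at hy
  obtain ⟨w1, w2, hw1, hw2, hw, k1, k2⟩ := h.exW' h1 h2 hm hy
  have hw12 : w1 ≠ w2 := h.ne_of (by omega)
  have hM : ∀ a b c, Cl d L a b → Cl d L b c → b ∈ ({p1, p2} : Finset V) := by
    intro a b c ha hb
    rcases h.middle h1 h2 hw1 hw2 hw k1 k2 ha hb with rfl | rfl | rfl
    · exfalso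
      refine h.noboth h1 h2 hw1 hw2 hw k1 k2 ha h3 ?_
      rintro rfl
      exact hp (h.tail_inj h3 ha)
    · simp
    · simp
  by_cases hs : ∃ s, s ∉ L ∧ s ≠ w1 ∧ s ≠ w2
  · obtain ⟨s, s1, s2, s3⟩ := hs
    refine h.count C hC {p1, p2} {s, w1, w2} hM ?_ ?_
    · intro o ho
      simp only [Finset.mem_insert, Finset.mem_singleton] at ho
      rcases ho with rfl | rfl | rfl <;> assumption
    · have a : ({s, w1, w2} : Finset V).card = 3 := by simp [*]
      have b : ({p1, p2} : Finset V).card ≤ 2 := Finset.card_le_two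
      omega
  · exfalso
    obtain ⟨z, hz⟩ := hu w1 w2 hw
    refine hz (h.univ4 h1 h2 h3 hp hw1 hw2 hw k1 k2 ?_ z)
    intro z hz
    by_contra hn
    push Not at hn
    exact hs ⟨z, hz, hn⟩

theorem seven [Fintype V] [Nontrivial V] (h : TD d)
    (hu : ∀ p q, d p q = 1 → ∃ z, ¬ (d z q = d z p + 1 ∨ d p z = d q z + 1))
    {u x v : V} (h1 : Cl d L u x) (h2 : Cl d L x v) (h3 : Cl d L v u)
    (hm : ∀ y, y ∉ L → (d y u = 1 ∧ d y x = 1 ∧ d y v = 1) ∨ (d u y = 1 ∧ d x y = 1 ∧ d v y = 1)) :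
    7 ≤ Fintype.card V := by
  by_contra hlt
  obtain ⟨y, hy⟩ := hu u x h1.1
  rw [← h1.2 y] at hy
  have e1 := h1.1
  have e2 := h2.1
  have e3 := h3.1
  have hc3 : ({u, x, v} : Finset V).card = 3 := by
    have b1 : u ≠ x := h.ne_of (by omega)
    have b2 : x ≠ v := h.ne_of (by omega)
    have b3 : u ≠ v := (h.ne_of (by omega : d v u ≠ 0)).symm
    simp [*]
  have hL3 : ∀ z ∈ ({u, x, v} : Finset V), z ∈ L := by
    intro z hz
    simp only [Finset.mem_insert, Finset.mem_singleton] at hz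
    rcases hz with rfl | rfl | rfl
    · exact h.left_mem h1
    · exact h.left_mem h2
    · exact h.left_mem h3
  -- no four distinct outsiders
  have small : ∀ O : Finset V, (∀ o ∈ O, o ∉ L) → O.card ≤ 3 := by
    intro O hO
    have : (O ∪ {u, x, v}).card = O.card + 3 := by
      rw [Finset.card_union_of_disjoint, hc3]
      rw [Finset.disjoint_left]
      exact fun z hz hz' => hO z hz (hL3 z hz')
    have := Finset.card_le_univ (O ∪ {u, x, v})
    omega
  have step : ∀ o, o ∉ L → ∃ s t, s ∉ L ∧ t ∉ L ∧ s ≠ t ∧ s ≠ o ∧ t ≠ o ∧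
      ((d o u = 1 ∧ d s o = 1 ∧ d t o = 1) ∨ (d u o = 1 ∧ d o s = 1 ∧ d o t = 1)) := by
    intro o ho
    have ou := h.tour o u
    have ox := h.tour o x
    have ov := h.tour o v
    rcases hm o ho with k | k
    · obtain ⟨s, -, s1⟩ := h.indeg hu o o
      obtain ⟨t, t2, t1⟩ := h.indeg hu o s
      have aux : ∀ s, d s o = 1 → s ∉ L := by
        intro s hs hsL
        rcases h.triangle h1 h2 h3 hsL with rfl | rfl | rfl <;> omega
      exact ⟨s, t, aux s s1, aux t t1, t2.symm, h.ne_of (by omega), h.ne_of (by omega),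
        Or.inl ⟨k.1, s1, t1⟩⟩
    · obtain ⟨s, -, s1⟩ := h.outdeg hu o o
      obtain ⟨t, t2, t1⟩ := h.outdeg hu o s
      have aux : ∀ s, d o s = 1 → s ∉ L := by
        intro s hs hsL
        rcases h.triangle h1 h2 h3 hsL with rfl | rfl | rfl <;> omega
      exact ⟨s, t, aux s s1, aux t t1, t2.symm, (h.ne_of (by omega)).symm,
        (h.ne_of (by omega)).symm, Or.inr ⟨k.1, s1, t1⟩⟩
  have step2 : ∀ o o', o ∉ L → o' ∉ L → o' ≠ o →
      (d o u = 1 ∧ d o' o = 1) ∨ (d u o = 1 ∧ d o o' = 1) := by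
    intro o o' ho ho' hne
    obtain ⟨s, t, hs, ht, n1, n2, n3, k⟩ := step o ho
    by_cases c1 : o' = s
    · subst c1; omega
    by_cases c2 : o' = t
    · subst c2; omega
    exfalso
    have : ({o', o, s, t} : Finset V).card = 4 := by
      have := n2.symm
      have := n3.symm
      simp [*]
    have := small {o', o, s, t} (by
      intro z hz
      simp only [Finset.mem_insert, Finset.mem_singleton] at hz
      rcases hz with rfl | rfl | rfl | rfl <;> assumption)
    omega
  obtain ⟨s, t, hs, ht, n1, n2, n3, -⟩ := step y hy
  have a1 := step2 y s hy hs n2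
  have a2 := step2 s y hs hy n2.symm
  have a3 := step2 y t hy ht n3
  have a4 := step2 t y ht hy n3.symm
  have a5 := step2 s t hs ht n1.symm
  have a6 := step2 t s ht hs n1
  have b1 := h.tour y u
  have b2 := h.tour s u
  have b3 := h.tour t u
  have b4 := h.tour y s
  have b5 := h.tour y t
  have b6 := h.tour s t
  omega

theorem bound [Fintype V] [Nontrivial V] (h : TD d)
    (hu : ∀ p q, d p q = 1 → ∃ z, ¬ (d z q = d z p + 1 ∨ d p z = d q z + 1))
    (C : Finset (V × V)) (hC : ∀ p, p ∈ C ↔ Cl d L p.1 p.2) :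
    2 * C.card ≤ Fintype.card V - 1 := by
  rcases C.eq_empty_or_nonempty with rfl | ⟨⟨p, q⟩, hpq⟩
  · simp
  have hpq' := (hC _).1 hpq
  obtain ⟨y, hy⟩ := hu p q hpq'.1
  rw [← hpq'.2 y] at hy
  by_cases hmid : ∃ u x v, Cl d L u x ∧ Cl d L x v
  swap
  · refine h.count C hC ∅ {y} ?_ (by simpa using hy) (by simp)
    intro a b c ha hb
    exact absurd ⟨a, b, c, ha, hb⟩ hmid
  obtain ⟨u, x, v, h1, h2⟩ := hmid
  have five := h.five hu
  by_cases hall : ∀ p ∈ C, p = (u, x) ∨ p = (x, v)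
  · have : C ⊆ {(u, x), (x, v)} := by
      intro p hp
      simpa using hall p hp
    have := (Finset.card_le_card this).trans Finset.card_le_two
    omega
  push Not at hall
  obtain ⟨⟨a, b⟩, hab, hne1, hne2⟩ := hall
  have hc : Cl d L a b := (hC _).1 hab
  have hau : a ≠ u := by
    rintro rfl; exact hne1 (by rw [h.tail_inj hc h1])
  have hax : a ≠ x := by
    rintro rfl; exact hne2 (by rw [h.tail_inj hc h2])
  have hbx : b ≠ x := by
    rintro rfl; exact hne1 (by rw [h.head_inj hc h1])
  have hbv : b ≠ v := by
    rintro rfl; exact hne2 (by rw [h.head_inj hc h2])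
  have hm := fun y (hy : y ∉ L) => h.nomid h1 h2 hc hau hax hbx hbv hy
  by_cases htri : Cl d L v u
  · have h7 := h.seven hu h1 h2 htri hm
    have hT : (C.image Prod.fst).card = C.card := by
      apply Finset.card_image_of_injOn
      rintro ⟨a, b⟩ hp ⟨a', b'⟩ hq (e : a = a')
      subst e
      have this : b = b' := h.tail_inj ((hC (a, b)).1 hp) ((hC (a, b')).1 hq)
      rw [this]
    have hsub : C.image Prod.fst ⊆ {u, x, v} := by
      intro z hz
      simp only [Finset.mem_image, Prod.exists, exists_and_right, exists_eq_right] at hz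
      obtain ⟨c, hc⟩ := hz
      have := h.triangle h1 h2 htri (h.left_mem ((hC _).1 hc))
      simpa using this
    have := (Finset.card_le_card hsub).trans Finset.card_le_three
    omega
  by_cases hv : ∃ b, Cl d L v b
  · obtain ⟨b, hb⟩ := hv
    exact h.four hu C hC h1 h2 hb (by rintro rfl; exact htri hb)
  by_cases hu' : ∃ a, Cl d L a u
  · obtain ⟨a, ha⟩ := hu'
    exact h.four hu C hC ha h1 h2 (by rintro rfl; exact htri ha)
  obtain ⟨w1, w2, hw1, hw2, hw, k1, k2⟩ := h.exW' h1 h2 hm hy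
  have hw12 : w1 ≠ w2 := h.ne_of (by omega)
  refine h.count C hC {x} {w1, w2} ?_ ?_ ?_
  · intro a b c ha hb
    rcases h.middle h1 h2 hw1 hw2 hw k1 k2 ha hb with rfl | rfl | rfl
    · exact absurd ⟨a, ha⟩ hu'
    · simp
    · exact absurd ⟨c, hb⟩ hv
  · intro o ho
    simp only [Finset.mem_insert, Finset.mem_singleton] at ho
    rcases ho with rfl | rfl <;> assumption
  · rw [Finset.card_pair hw12]; simp

end TD

theorem stepsTo_add {V : Type*} (A : V → V → Prop) (m n : ℕ) : ∀ u v w,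
    stepsTo A m u v → stepsTo A n v w → stepsTo A (m + n) u w := by
  induction m with
  | zero =>
    intro u v w h1 h2
    have : u = v := h1
    subst this
    simpa using h2
  | succ m ih =>
    rintro u v w ⟨t, ht, h1⟩ h2
    rw [Nat.add_right_comm]
    exact ⟨t, ht, ih _ _ _ h1 h2⟩

theorem stepsTo_last {V : Type*} (A : V → V → Prop) (m : ℕ) : ∀ u w,
    stepsTo A (m + 1) u w → ∃ v, stepsTo A m u v ∧ A v w := by
  induction m with
  | zero =>
    rintro u w ⟨t, ht, h1⟩
    have : t = w := h1
    subst this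
    exact ⟨u, rfl, ht⟩
  | succ m ih =>
    rintro u w ⟨t, ht, h1⟩
    obtain ⟨v, hv, hvw⟩ := ih _ _ h1
    exact ⟨v, ⟨t, ht, hv⟩, hvw⟩

theorem td_ddist {V : Type*} (A : V → V → Prop)
    (hanti : ∀ u v : V, ¬ (A u v ∧ A v u))
    (hcomp : ∀ u v : V, u ≠ v → A u v ∨ A v u)
    (hsc : StronglyConnected A) :
    TD (ddist A) ∧ ∀ u v, ddist A u v = 1 ↔ A u v := by
  have sp : ∀ u v, stepsTo A (ddist A u v) u v := fun u v => Nat.sInf_mem (hsc u v)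
  have le : ∀ u v n, stepsTo A n u v → ddist A u v ≤ n := fun u v n hn => Nat.sInf_le hn
  have zero : ∀ p q, ddist A p q = 0 ↔ p = q := by
    intro p q
    constructor
    · intro e
      have := sp p q
      rw [e] at this
      exact this
    · intro e
      exact Nat.le_zero.1 (le p q 0 e)
  have one' : ∀ u v, A u v → stepsTo A 1 u v := fun u v huv => ⟨v, huv, rfl⟩
  have one : ∀ u v, ddist A u v = 1 ↔ A u v := by
    intro u v
    constructor
    · intro e
      have := sp u v
      rw [e] at this
      obtain ⟨w, hw, hwv⟩ := this
      have : w = v := hwv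
      exact this ▸ hw
    · intro huv
      have h1 := le u v 1 (one' u v huv)
      have h2 : ddist A u v ≠ 0 := by
        intro e
        rw [zero] at e
        subst e
        exact hanti u u ⟨huv, huv⟩
      omega
  have tri : ∀ p q r, ddist A p r ≤ ddist A p q + ddist A q r := fun p q r =>
    le _ _ _ (stepsTo_add A _ _ _ _ _ (sp p q) (sp q r))
  refine ⟨⟨zero, tri, ?_, ?_, ?_⟩, one⟩
  · intro p q
    by_cases hpq : p = q
    · subst hpq; left; simp [zero]
    · right
      have a := hanti p q
      have b := hcomp p q hpq
      have c : ddist A p q ≠ 0 := fun e => hpq ((zero _ _).1 e)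
      have c' : ddist A q p ≠ 0 := fun e => hpq ((zero _ _).1 e).symm
      rw [← one, ← one] at a b
      omega
  · intro p q hpq
    have c : ddist A p q ≠ 0 := fun e => hpq ((zero _ _).1 e)
    obtain ⟨n, hn⟩ := Nat.exists_eq_succ_of_ne_zero c
    have s := sp p q
    rw [hn] at s
    obtain ⟨w, hw, hwq⟩ := s
    have h1 := (one p w).2 hw
    have h2 := le _ _ _ hwq
    have h3 := tri p w q
    exact ⟨w, h1, by omega⟩
  · intro p q hpq
    have c : ddist A p q ≠ 0 := fun e => hpq ((zero _ _).1 e)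
    obtain ⟨n, hn⟩ := Nat.exists_eq_succ_of_ne_zero c
    have s := sp p q
    rw [hn] at s
    obtain ⟨w, hw, hwq⟩ := stepsTo_last A _ _ _ s
    have h1 := (one w q).2 hwq
    have h2 := le _ _ _ hw
    have h3 := tri p w q
    exact ⟨w, h1, by omega⟩

theorem mem_line_arc {V : Type*} (A : V → V → Prop) (h : TD (ddist A)) {p q : V}
    (hpq : ddist A p q = 1) (z : V) : z ∈ line A p q ↔
      (ddist A z q = ddist A z p + 1 ∨ ddist A p z = ddist A q z + 1) := by
  change (ddist A z q = ddist A z p + ddist A p q ∨ ddist A p z = ddist A p q + ddist A q z ∨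
    ddist A p q = ddist A p z + ddist A z q) ↔ _
  rw [hpq]
  constructor
  · rintro (e | e | e)
    · exact Or.inl e
    · right; omega
    · by_cases e0 : ddist A p z = 0
      · rw [h.zero] at e0
        subst e0
        left; rw [h.self, hpq]
      · have e1 : ddist A z q = 0 := by omega
        rw [h.zero] at e1
        subst e1
        right; rw [h.self, hpq]
  · rintro (e | e)
    · exact Or.inl e
    · right; left; omega

theorem stmt14 {V : Type*} [Fintype V] [Nontrivial V] (A : V → V → Prop)
    (hanti : ∀ u v : V, ¬ (A u v ∧ A v u))
    (hcomp : ∀ u v : V, u ≠ v → A u v ∨ A v u)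
    (hsc : StronglyConnected A) :
    (Set.univ : Set V) ∈ lineSet A ∨ Fintype.card V ≤ (lineSet A).ncard := by
  by_cases huniv : (Set.univ : Set V) ∈ lineSet A
  · exact Or.inl huniv
  right
  obtain ⟨h, one⟩ := td_ddist A hanti hcomp hsc
  have hu : ∀ p q, ddist A p q = 1 →
      ∃ z, ¬ (ddist A z q = ddist A z p + 1 ∨ ddist A p z = ddist A q z + 1) := by
    intro p q hpq
    by_contra hcon
    push Not at hcon
    apply huniv
    refine ⟨p, q, h.ne_of (by omega), ?_⟩
    symm
    rw [Set.eq_univ_iff_forall]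
    intro z
    rw [mem_line_arc A h hpq z]
    by_contra hn
    push Not at hn
    have := hcon z
    tauto
  let arcs : Finset (V × V) := Finset.univ.filter (fun p => A p.1 p.2)
  have hfib : ∀ L ∈ arcs.image (fun p => line A p.1 p.2),
      (arcs.filter (fun p => line A p.1 p.2 = L)).card ≤ (Fintype.card V - 1) / 2 := by
    intro L _
    have := h.bound (L := L) hu (arcs.filter (fun p => line A p.1 p.2 = L)) (by
      rintro ⟨p, q⟩
      simp only [arcs, Finset.mem_filter, Finset.mem_univ, true_and]
      constructor
      · rintro ⟨hA, rfl⟩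
        have := (one p q).2 hA
        exact ⟨this, fun z => mem_line_arc A h this z⟩
      · rintro ⟨h1, h2⟩
        refine ⟨(one p q).1 h1, ?_⟩
        ext z
        rw [mem_line_arc A h h1 z, h2 z])
    omega
  have hle := Finset.card_le_mul_card_image arcs _ hfib
  have himg : (arcs.image (fun p => line A p.1 p.2)).card ≤ (lineSet A).ncard := by
    rw [← Set.ncard_coe_finset]
    apply Set.ncard_le_ncard _ (Set.toFinite _)
    intro L hL
    simp only [Finset.coe_image, Set.mem_image, Finset.mem_coe] at hL
    obtain ⟨⟨p, q⟩, hp, rfl⟩ := hL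
    simp only [arcs, Finset.mem_filter, Finset.mem_univ, true_and] at hp
    refine ⟨p, q, ?_, rfl⟩
    rintro rfl
    exact hanti p p ⟨hp, hp⟩
  have hcard : Fintype.card V * Fintype.card V - Fintype.card V ≤ 2 * arcs.card := by
    have e := Finset.offDiag_card (Finset.univ : Finset V)
    rw [Finset.card_univ] at e
    rw [← e]
    have hsub : (Finset.univ : Finset V).offDiag ⊆ arcs ∪ arcs.image Prod.swap := by
      rintro ⟨p, q⟩ hpq
      simp only [Finset.mem_offDiag, Finset.mem_univ, true_and] at hpq
      rw [Finset.mem_union]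
      rcases hcomp p q hpq with k | k
      · left; simpa [arcs] using k
      · right
        rw [Finset.mem_image]
        exact ⟨(q, p), by simpa [arcs] using k, rfl⟩
    have h1 := Finset.card_le_card hsub
    have h2 := Finset.card_union_le arcs (arcs.image Prod.swap)
    have h3 : (arcs.image Prod.swap).card ≤ arcs.card := Finset.card_image_le
    omega
  have hn : 2 ≤ Fintype.card V := Fintype.one_lt_card
  refine le_trans ?_ himg
  generalize (arcs.image (fun p => line A p.1 p.2)).card = k at *
  generalize arcs.card = m at *
  generalize Fintype.card V = n at *
  obtain ⟨t, rfl⟩ : ∃ t, n = t + 1 := ⟨n - 1, by omega⟩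
  have ht : 2 * (t / 2) ≤ t := by omega
  simp only [Nat.add_sub_cancel] at hle
  have h5 : (t + 1) * (t + 1) - (t + 1) = (t + 1) * t := by
    rw [Nat.mul_succ, Nat.add_sub_cancel]
  rw [h5] at hcard
  have h6 : (t + 1) * t ≤ k * t := by nlinarith
  exact Nat.le_of_mul_le_mul_right h6 (by omega)
end

section
/- Every orientation of a complete bipartite graph with oriented diameter at most three on n vertices either has a universal line or has at least n distinct lines. -/
open scoped Classical

structure BT {V : Type*} (A : V → V → Prop) (X Y : Set V) : Prop where
  hpart : ∀ v : V, (v ∈ X ∧ v ∉ Y) ∨ (v ∈ Y ∧ v ∉ X)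
  hanti : ∀ u v : V, ¬ (A u v ∧ A v u)
  hadj : ∀ u v : V, (A u v ∨ A v u) ↔ ((u ∈ X ∧ v ∈ Y) ∨ (u ∈ Y ∧ v ∈ X))
  hdiam : ∀ u v : V, ∃ n : ℕ, n ≤ 3 ∧ stepsTo A n u v

namespace BT

variable {V : Type*} {A : V → V → Prop} {X Y : Set V}

theorem swap (h : BT A X Y) : BT A Y X :=
  ⟨fun v => (h.hpart v).symm, h.hanti, fun u v => (h.hadj u v).trans or_comm, h.hdiam⟩

theorem arc_part (h : BT A X Y) {u v : V} (a : A u v) : u ∈ X ↔ v ∉ X := by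
  have h1 := (h.hadj u v).1 (Or.inl a)
  have h2 := h.hpart u
  have h3 := h.hpart v
  tauto

theorem same_part (h : BT A X Y) {u v : V} (huv : u ∈ X ↔ v ∈ X) : ¬ A u v := by
  intro a
  have := h.arc_part a
  tauto

theorem arc_or (h : BT A X Y) {u v : V} (huv : u ∈ X ↔ v ∉ X) : A u v ∨ A v u := by
  have h2 := h.hpart u
  have h3 := h.hpart v
  rw [h.hadj]
  tauto

theorem spec (h : BT A X Y) (u v : V) : ddist A u v ≤ 3 ∧ stepsTo A (ddist A u v) u v := by
  obtain ⟨n, hn, hs⟩ := h.hdiam u v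
  exact ⟨(Nat.sInf_le hs).trans hn, Nat.sInf_mem (s := {n | stepsTo A n u v}) ⟨n, hs⟩⟩

theorem cases4 (h : BT A X Y) (u v : V) :
    (ddist A u v = 0 ∧ u = v) ∨ (ddist A u v = 1 ∧ A u v) ∨
    (ddist A u v = 2 ∧ ∃ w, A u w ∧ A w v) ∨
    (ddist A u v = 3 ∧ ∃ w x, A u w ∧ A w x ∧ A x v) := by
  obtain ⟨h1, h2⟩ := h.spec u v
  generalize ddist A u v = n at *
  interval_cases n <;> simp_all [stepsTo]

theorem d_self (u : V) : ddist A u u = 0 := by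
  have : ddist A u u ≤ 0 := Nat.sInf_le (show stepsTo A 0 u u from rfl)
  omega

theorem d_arc (h : BT A X Y) {u v : V} (a : A u v) : ddist A u v = 1 := by
  have h1 : ddist A u v ≤ 1 := Nat.sInf_le (show stepsTo A 1 u v from ⟨v, a, rfl⟩)
  rcases h.cases4 u v with ⟨h2, h3⟩ | ⟨h2, h3⟩ | ⟨h2, h3⟩ | ⟨h2, h3⟩
  · subst h3
    exact absurd ⟨a, a⟩ (h.hanti _ _)
  all_goals omega

theorem d_rev (h : BT A X Y) {u v : V} (a : A v u) :
    ddist A u v = 3 ∧ ∃ w x, A u w ∧ A w x ∧ A x v := by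
  rcases h.cases4 u v with ⟨h2, h3⟩ | ⟨h2, h3⟩ | ⟨h2, w, h3, h4⟩ | ⟨h2, h3⟩
  · subst h3
    exact absurd ⟨a, a⟩ (h.hanti _ _)
  · exact absurd ⟨a, h3⟩ (h.hanti _ _)
  · have := h.arc_part a
    have := h.arc_part h3
    have := h.arc_part h4
    tauto
  · exact ⟨h2, h3⟩

theorem d_same (h : BT A X Y) {u v : V} (huv : u ∈ X ↔ v ∈ X) (hne : u ≠ v) :
    ddist A u v = 2 ∧ ∃ w, A u w ∧ A w v := by
  rcases h.cases4 u v with ⟨h2, h3⟩ | ⟨h2, h3⟩ | ⟨h2, h3⟩ | ⟨h2, w, x, h3, h4, h5⟩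
  · exact absurd h3 hne
  · exact absurd h3 (h.same_part huv)
  · exact ⟨h2, h3⟩
  · have := h.arc_part h3
    have := h.arc_part h4
    have := h.arc_part h5
    tauto

theorem line_arc (h : BT A X Y) {u v : V} (a : A u v)
    (hz : ∀ z, z ≠ u → z ≠ v → A z u ∨ A v z) : line A u v = Set.univ := by
  ext z
  simp only [line, _root_.btw, Set.mem_ofPred_eq, Set.mem_univ, iff_true]
  have huv := h.arc_part a
  have d1 := h.d_arc a
  by_cases e1 : z = u
  · subst e1; simp [d_self]
  by_cases e2 : z = v
  · subst e2; simp [d_self]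
  rcases hz z e1 e2 with b | b
  · have d2 := h.d_arc b
    have d3 := (h.d_rev b).1
    have := h.arc_part b
    have d4 := (h.d_same (show z ∈ X ↔ v ∈ X by tauto) e2).1
    left; omega
  · have d2 := h.d_arc b
    have := h.arc_part b
    have d4 := (h.d_same (show u ∈ X ↔ z ∈ X by tauto) (Ne.symm e1)).1
    right; left; omega

theorem line_same (h : BT A X Y) {u v : V} (huv : u ∈ X ↔ v ∈ X) (hne : u ≠ v) (z : V) :
    z ∈ line A u v ↔ z = u ∨ z = v ∨ (A u z ∧ A z v) ∨ (A v z ∧ A z u) := by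
  simp only [line, _root_.btw, Set.mem_ofPred_eq]
  have d1 := (h.d_same huv hne).1
  by_cases e1 : z = u
  · subst e1; simp [d_self]
  by_cases e2 : z = v
  · subst e2; simp [d_self]
  simp only [e1, e2, false_or]
  by_cases hzu : z ∈ X ↔ u ∈ X
  · have d2 := (h.d_same hzu e1).1
    have d3 := (h.d_same (show u ∈ X ↔ z ∈ X by tauto) (Ne.symm e1)).1
    have d4 := (h.d_same (show z ∈ X ↔ v ∈ X by tauto) e2).1
    have d5 := (h.d_same (show v ∈ X ↔ z ∈ X by tauto) (Ne.symm e2)).1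
    have n1 := h.same_part hzu
    have n2 := h.same_part (show z ∈ X ↔ v ∈ X by tauto)
    simp [d1, d2, d3, d4, d5, n1, n2]
  · have o1 := h.arc_or (show z ∈ X ↔ u ∉ X by tauto)
    have o2 := h.arc_or (show z ∈ X ↔ v ∉ X by tauto)
    have x1 := h.hanti z u
    have x2 := h.hanti z v
    rcases o1 with b | b <;> rcases o2 with c | c <;>
      have d2 := h.d_arc b <;> have d3 := (h.d_rev b).1 <;>
      have d4 := h.d_arc c <;> have d5 := (h.d_rev c).1 <;>
      simp [d1, d2, d3, d4, d5, b, c] <;> tauto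

theorem out_in [Nontrivial V] (h : BT A X Y) (z : V) : (∃ w, A z w) ∧ (∃ w, A w z) := by
  obtain ⟨v, hv⟩ := exists_ne z
  have h1 : ∃ w, A z w := by
    rcases h.cases4 z v with ⟨_, h3⟩ | ⟨_, h3⟩ | ⟨_, w, h3, _⟩ | ⟨_, w, x, h3, _⟩
    · exact absurd h3.symm hv
    all_goals exact ⟨_, h3⟩
  refine ⟨h1, ?_⟩
  obtain ⟨w, hw⟩ := h1
  obtain ⟨_, a, b, _, _, hb⟩ := h.d_rev hw
  exact ⟨b, hb⟩

theorem sing_out (h : BT A X Y) {x y : V} (a : A x y) (hs : ∀ z, A x z → z = y) :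
    (Set.univ : Set V) ∈ lineSet A := by
  refine ⟨x, y, ?_, (h.line_arc a ?_).symm⟩
  · rintro rfl
    exact h.hanti _ _ ⟨a, a⟩
  · intro z hx hy
    have := h.arc_part a
    by_cases hz : z ∈ X ↔ x ∈ X
    · obtain ⟨_, w, h1, h2⟩ := h.d_same hz.symm (Ne.symm hx)
      rw [hs w h1] at h2
      exact Or.inr h2
    · rcases h.arc_or (show z ∈ X ↔ x ∉ X by tauto) with b | b
      · exact Or.inl b
      · exact absurd (hs z b) hy

theorem sing_in (h : BT A X Y) {x y : V} (a : A y x) (hs : ∀ z, A z x → z = y) :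
    (Set.univ : Set V) ∈ lineSet A := by
  refine ⟨y, x, ?_, (h.line_arc a ?_).symm⟩
  · rintro rfl
    exact h.hanti _ _ ⟨a, a⟩
  · intro z hy hx
    have := h.arc_part a
    by_cases hz : z ∈ X ↔ x ∈ X
    · obtain ⟨_, w, h1, h2⟩ := h.d_same hz hx
      rw [hs w h2] at h1
      exact Or.inl h1
    · rcases h.arc_or (show z ∈ X ↔ x ∉ X by tauto) with b | b
      · exact absurd (hs z b) hy
      · exact Or.inr b

set_option maxHeartbeats 4000000 in
/-- Consequences of an `X`-pair and a `Y`-pair generating the same line. -/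
theorem overlap (h : BT A X Y) {x x' y y' : V} (hx : x ∈ X) (hx' : x' ∈ X) (hne : x ≠ x')
    (hy : y ∈ Y) (hy' : y' ∈ Y) (hne' : y ≠ y') (he : line A x x' = line A y y') :
    ∃ a b, A x a ∧ A a x' ∧ A x' b ∧ A b x ∧
      (∀ z, z ≠ a → z ≠ b → (A x z ↔ A x' z) ∧ (A z x ↔ A z x')) ∧
      (∀ z, z ≠ x → z ≠ x' → (A a z ↔ A b z) ∧ (A z a ↔ A z b)) := by
  have pY : ∀ v, v ∈ Y ↔ v ∉ X := fun v => by have := h.hpart v; tauto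
  have L1 := h.line_same (show x ∈ X ↔ x' ∈ X by simp [hx, hx']) hne
  rw [he] at L1
  have L2 := h.line_same (show y ∈ X ↔ y' ∈ X by simp_all) hne'
  obtain ⟨_, a, xa, ax⟩ := h.d_same (show x ∈ X ↔ x' ∈ X by simp [hx, hx']) hne
  obtain ⟨_, b, xb, bx⟩ := h.d_same (show x' ∈ X ↔ x ∈ X by simp [hx, hx']) hne.symm
  have pa := h.arc_part xa
  have pb := h.arc_part xb
  -- membership of Y-vertices
  have key : ∀ z, z ∉ X → (((A x z ∧ A z x') ∨ (A x' z ∧ A z x)) ↔ (z = y ∨ z = y')) := by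
    intro z hz
    have n1 : z ≠ x := fun e => hz (e ▸ hx)
    have n2 : z ≠ x' := fun e => hz (e ▸ hx')
    have n3 := h.same_part (show y ∈ X ↔ z ∈ X by simp_all)
    have n4 := h.same_part (show y' ∈ X ↔ z ∈ X by simp_all)
    have := (L1 z).symm.trans (L2 z)
    clear L1 L2 he
    grind
  have key2 : ∀ z, z ∈ X → (((A y z ∧ A z y') ∨ (A y' z ∧ A z y)) ↔ (z = x ∨ z = x')) := by
    intro z hz
    have n1 : z ≠ y := fun e => (pY y).1 hy (e ▸ hz)
    have n2 : z ≠ y' := fun e => (pY y').1 hy' (e ▸ hz)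
    have n3 := h.same_part (show x ∈ X ↔ z ∈ X by simp_all)
    have n4 := h.same_part (show x' ∈ X ↔ z ∈ X by simp_all)
    have := (L1 z).symm.trans (L2 z)
    clear L1 L2 he
    grind
  have hab : a ≠ b := by
    rintro rfl
    exact h.hanti _ _ ⟨xa, bx⟩
  have ka := (key a (by grind)).1 (Or.inl ⟨xa, ax⟩)
  have kb := (key b (by grind)).1 (Or.inr ⟨xb, bx⟩)
  refine ⟨a, b, xa, ax, xb, bx, ?_, ?_⟩
  · intro z za zb
    by_cases hz : z ∈ X
    · have n1 := h.same_part (show x ∈ X ↔ z ∈ X by clear L1 L2 key key2 pY he; grind)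
      have n2 := h.same_part (show x' ∈ X ↔ z ∈ X by clear L1 L2 key key2 pY he; grind)
      have n3 := h.same_part (show z ∈ X ↔ x ∈ X by clear L1 L2 key key2 pY he; grind)
      have n4 := h.same_part (show z ∈ X ↔ x' ∈ X by clear L1 L2 key key2 pY he; grind)
      clear L1 L2 key key2 pY he
      grind
    · have k := key z hz
      have : ¬ (z = y ∨ z = y') := by
        clear L1 L2 key key2 pY he; grind
      have o1 := h.arc_or (show x ∈ X ↔ z ∉ X by clear L1 L2 key key2 pY he; grind)
      have o2 := h.arc_or (show x' ∈ X ↔ z ∉ X by clear L1 L2 key key2 pY he; grind)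
      have x1 := h.hanti x z
      have x2 := h.hanti x' z
      clear L1 L2 key key2 pY he
      grind
  · intro z zx zx'
    by_cases hz : z ∈ X
    · have k := key2 z hz
      have o1 := h.arc_or (show z ∈ X ↔ a ∉ X by clear L1 L2 key key2 pY he; grind)
      have o2 := h.arc_or (show z ∈ X ↔ b ∉ X by clear L1 L2 key key2 pY he; grind)
      have x1 := h.hanti z a
      have x2 := h.hanti z b
      clear L1 L2 key key2 pY he
      grind
    · have n1 := h.same_part (show a ∈ X ↔ z ∈ X by clear L1 L2 key key2 pY he; grind)
      have n2 := h.same_part (show b ∈ X ↔ z ∈ X by clear L1 L2 key key2 pY he; grind)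
      have n3 := h.same_part (show z ∈ X ↔ a ∈ X by clear L1 L2 key key2 pY he; grind)
      have n4 := h.same_part (show z ∈ X ↔ b ∈ X by clear L1 L2 key key2 pY he; grind)
      clear L1 L2 key key2 pY he
      grind

theorem equiv_union {ι β γ : Type*} (f : ι → β) (g : ι → γ)
    (hfg : ∀ i j, f i = f j ∨ g i = g j) : (∀ i j, f i = f j) ∨ (∀ i j, g i = g j) := by
  by_contra hc
  push Not at hc
  obtain ⟨⟨i, j, hij⟩, k, l, hkl⟩ := hc
  have := hfg i j
  have := hfg k l
  have := hfg i k
  have := hfg i l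
  have := hfg j k
  have := hfg j l
  grind

theorem star [Nontrivial V] (h : BT A X Y) {x : V} (hx : x ∈ X)
    (hall : ∀ x' ∈ X, x ≠ x' → ∃ y y', y ∈ Y ∧ y' ∈ Y ∧ y ≠ y' ∧ line A x x' = line A y y') :
    (Set.univ : Set V) ∈ lineSet A := by
  have H : ∀ i : {v // v ∈ X ∧ x ≠ v}, ∃ a b, A x a ∧ A a i ∧ A i b ∧ A b x ∧
      (∀ z, z ≠ a → z ≠ b → (A x z ↔ A i z) ∧ (A z x ↔ A z i)) ∧
      (∀ z, z ≠ x → z ≠ i → (A a z ↔ A b z) ∧ (A z a ↔ A z b)) := by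
    rintro ⟨x', h1, h2⟩
    obtain ⟨y, y', hy, hy', hne, he⟩ := hall x' h1 h2
    exact h.overlap hx h1 h2 hy hy' hne he
  choose a b h1 h2 h3 h4 h5 h6 using H
  have hab : ∀ i j, a i = a j ∨ b i = b j := by
    intro i j
    by_contra hc
    push Not at hc
    have e1 : a i ≠ b j := fun e => h.hanti _ _ ⟨h1 i, e ▸ h4 j⟩
    have e2 : b i ≠ a j := fun e => h.hanti _ _ ⟨h1 j, e ▸ h4 i⟩
    have ij : (j : V) ≠ i := by
      intro e
      exact hc.1 (congrArg a (Subtype.ext e.symm))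
    -- on `a i`, `j` agrees with `x`; on `b i` too, but `a i`, `b i` agree at `j`
    have k1 := (h5 j (a i) hc.1 e1).1.1 (h1 i)
    have k2 := (h5 j (b i) e2 hc.2).2.1 (h4 i)
    have k3 := (h6 i j j.2.2.symm ij).1.2 k2
    exact h.hanti _ _ ⟨k1, k3⟩
  have noz : ∀ z, (z ∉ X) → ¬ ∀ i, z ≠ a i ∧ z ≠ b i := by
    intro z hz hh
    have ag : ∀ x' ∈ X, (A x z ↔ A x' z) ∧ (A z x ↔ A z x') := by
      intro x' hx'
      by_cases e : x = x'
      · subst e; simp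
      · exact h5 ⟨x', hx', e⟩ z (hh _).1 (hh _).2
    obtain ⟨⟨w, hw⟩, w', hw'⟩ := h.out_in z
    have p1 := h.arc_part hw
    have p2 := h.arc_part hw'
    have q1 := (ag w (by tauto)).2.2 hw
    have q2 := (ag w' (by tauto)).1.2 hw'
    exact h.hanti _ _ ⟨q1, q2⟩
  obtain ⟨⟨w, hw⟩, w', hw'⟩ := h.out_in x
  rcases equiv_union a b hab with hc | hc
  · refine h.sing_out hw ?_
    have : ∀ z, A x z → ∃ i, z = a i := by
      intro z hz
      have p := h.arc_part hz
      have := noz z (by tauto)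
      push Not at this
      obtain ⟨i, hi⟩ := this
      refine ⟨i, ?_⟩
      by_contra hn
      exact h.hanti _ _ ⟨hz, hi hn ▸ h4 i⟩
    intro z hz
    obtain ⟨i, rfl⟩ := this z hz
    obtain ⟨j, rfl⟩ := this w hw
    exact hc _ _
  · refine h.sing_in hw' ?_
    have : ∀ z, A z x → ∃ i, z = b i := by
      intro z hz
      have p := h.arc_part hz
      have := noz z (by tauto)
      push Not at this
      obtain ⟨i, hi⟩ := this
      refine ⟨i, hi ?_⟩
      rintro rfl
      exact h.hanti _ _ ⟨hz, h1 i⟩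
    intro z hz
    obtain ⟨i, rfl⟩ := this z hz
    obtain ⟨j, rfl⟩ := this w' hw'
    exact hc _ _

theorem small [Fintype V] [Nontrivial V] (h : BT A X Y) {x : V} (hx : x ∈ X)
    (hq : (Finset.univ.filter (· ∈ Y)).card ≤ 3) : (Set.univ : Set V) ∈ lineSet A := by
  have pY : ∀ v, v ∈ Y ↔ v ∉ X := fun v => by have := h.hpart v; tauto
  obtain ⟨⟨w, hw⟩, w', hw'⟩ := h.out_in x
  by_contra hc
  have c1 : ∃ z, A x z ∧ z ≠ w := by
    by_contra hn
    push Not at hn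
    exact hc (h.sing_out hw hn)
  have c2 : ∃ z, A z x ∧ z ≠ w' := by
    by_contra hn
    push Not at hn
    exact hc (h.sing_in hw' hn)
  obtain ⟨z, hz, zw⟩ := c1
  obtain ⟨z', hz', zw'⟩ := c2
  have hsub : ({w, z, w', z'} : Finset V) ⊆ Finset.univ.filter (· ∈ Y) := by
    have := h.arc_part hw
    have := h.arc_part hz
    have := h.arc_part hw'
    have := h.arc_part hz'
    intro t ht
    simp only [Finset.mem_insert, Finset.mem_singleton] at ht
    simp only [Finset.mem_filter, Finset.mem_univ, true_and, pY]
    rcases ht with rfl | rfl | rfl | rfl <;> tauto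
  have hcard : ({w, z, w', z'} : Finset V).card = 4 := by
    have e : ∀ s t, A x s → A t x → s ≠ t := by
      rintro s t a b rfl
      exact h.hanti _ _ ⟨a, b⟩
    rw [Finset.card_insert_of_notMem, Finset.card_insert_of_notMem,
      Finset.card_insert_of_notMem, Finset.card_singleton]
    · simpa using zw'.symm
    · simp [e _ _ hz hw', e _ _ hz hz']
    · simp [e _ _ hw hw', e _ _ hw hz', zw.symm]
  have := Finset.card_le_card hsub
  omega

theorem main [Fintype V] [Nontrivial V] (h : BT A X Y)
    (hpq : (Finset.univ.filter (· ∈ X)).card ≤ (Finset.univ.filter (· ∈ Y)).card) :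
    (Set.univ : Set V) ∈ lineSet A ∨ Fintype.card V ≤ (lineSet A).ncard := by
  by_cases hu : (Set.univ : Set V) ∈ lineSet A
  · exact Or.inl hu
  right
  have pY : ∀ v, v ∈ Y ↔ v ∉ X := fun v => by have := h.hpart v; tauto
  have hXne : ∃ x, x ∈ X := by
    obtain ⟨v, _⟩ := exists_pair_ne V
    obtain ⟨⟨w, hw⟩, _⟩ := h.out_in v
    have := h.arc_part hw
    by_cases hv : v ∈ X
    · exact ⟨v, hv⟩
    · exact ⟨w, by tauto⟩
  obtain ⟨x₀, hx₀⟩ := hXne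
  have hq : 4 ≤ (Finset.univ.filter (· ∈ Y)).card := by
    by_contra hn
    exact hu (h.small hx₀ (by omega))
  let LY : Finset (Set V) :=
    Finset.univ.filter fun S => ∃ y y', y ∈ Y ∧ y' ∈ Y ∧ y ≠ y' ∧ S = line A y y'
  let LX : Finset (Set V) :=
    Finset.univ.filter fun S => S ∉ LY ∧ ∃ x x', x ∈ X ∧ x' ∈ X ∧ x ≠ x' ∧ S = line A x x'
  have lineY : ∀ y y', y ∈ Y → y' ∈ Y → y ≠ y' → ∀ z ∈ Y, (z ∈ line A y y' ↔ z = y ∨ z = y') := by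
    intro y y' hy hy' hne z hz
    rw [h.line_same (by simp_all) hne]
    have n3 := h.same_part (show y ∈ X ↔ z ∈ X by simp_all)
    have n4 := h.same_part (show y' ∈ X ↔ z ∈ X by simp_all)
    tauto
  have lineX : ∀ y y', y ∈ X → y' ∈ X → y ≠ y' → ∀ z ∈ X, (z ∈ line A y y' ↔ z = y ∨ z = y') := by
    intro y y' hy hy' hne z hz
    rw [h.line_same (by simp_all) hne]
    have n3 := h.same_part (show y ∈ X ↔ z ∈ X by simp_all)
    have n4 := h.same_part (show y' ∈ X ↔ z ∈ X by simp_all)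
    tauto
  have cY : (Finset.univ.filter (· ∈ Y)).card.choose 2 ≤ LY.card := by
    rw [← Finset.card_powersetCard]
    refine le_trans (Finset.card_le_card (t := LY.image fun S =>
      Finset.univ.filter fun v => v ∈ S ∧ v ∈ Y) ?_) Finset.card_image_le
    intro s hs
    rw [Finset.mem_powersetCard, Finset.card_eq_two] at hs
    obtain ⟨hs, y, y', hne, rfl⟩ := hs
    have hy : y ∈ Y := by simpa using hs (show y ∈ ({y, y'} : Finset V) by simp)
    have hy' : y' ∈ Y := by simpa using hs (show y' ∈ ({y, y'} : Finset V) by simp)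
    rw [Finset.mem_image]
    refine ⟨line A y y', ?_, ?_⟩
    · simp only [LY, Finset.mem_filter, Finset.mem_univ, true_and]
      exact ⟨y, y', hy, hy', hne, rfl⟩
    · ext z
      simp only [Finset.mem_filter, Finset.mem_univ, true_and, Finset.mem_insert,
        Finset.mem_singleton]
      constructor
      · rintro ⟨h1, h2⟩
        exact (lineY y y' hy hy' hne z h2).1 h1
      · intro h1
        have h2 : z ∈ Y := by rcases h1 with rfl | rfl <;> assumption
        exact ⟨(lineY y y' hy hy' hne z h2).2 h1, h2⟩
  have cX : (Finset.univ.filter (· ∈ X)).card ≤ LX.card * 2 := by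
    refine le_trans (Finset.card_le_card (t := LX.biUnion fun S =>
      Finset.univ.filter fun v => v ∈ S ∧ v ∈ X) ?_) (Finset.card_biUnion_le_card_mul _ _ _ ?_)
    · intro x hx
      have hx : x ∈ X := by simpa using hx
      by_contra hn
      apply hu
      apply h.star hx
      intro x' hx' hne
      by_contra hno
      apply hn
      rw [Finset.mem_biUnion]
      refine ⟨line A x x', ?_, ?_⟩
      · simp only [LX, LY, Finset.mem_filter, Finset.mem_univ, true_and]
        exact ⟨hno, x, x', hx, hx', hne, rfl⟩
      · simp only [Finset.mem_filter, Finset.mem_univ, true_and]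
        exact ⟨(lineX x x' hx hx' hne x hx).2 (Or.inl rfl), hx⟩
    · intro S hS
      simp only [LX, Finset.mem_filter, Finset.mem_univ, true_and] at hS
      obtain ⟨_, x, x', hx, hx', hne, rfl⟩ := hS
      refine le_trans (Finset.card_le_card (t := {x, x'}) ?_) Finset.card_le_two
      intro z hz
      simp only [Finset.mem_filter, Finset.mem_univ, true_and] at hz
      simpa using (lineX x x' hx hx' hne z hz.2).1 hz.1
  have cL : LY.card + LX.card ≤ (lineSet A).ncard := by
    rw [← Finset.card_union_of_disjoint, ← Set.ncard_coe_finset]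
    · refine Set.ncard_le_ncard ?_ (Set.toFinite _)
      intro S hS
      simp only [LX, LY, Finset.coe_union, Finset.coe_filter, Finset.mem_univ, true_and,
        Set.mem_union, Set.mem_ofPred_eq] at hS
      rcases hS with ⟨y, y', _, _, hne, e⟩ | ⟨_, y, y', _, _, hne, e⟩
      · exact ⟨y, y', hne, e⟩
      · exact ⟨y, y', hne, e⟩
    · rw [Finset.disjoint_left]
      intro S h1 h2
      simp only [LX, Finset.mem_filter] at h2
      exact h2.2.1 h1
  have cV : Fintype.card V =
      (Finset.univ.filter (· ∈ X)).card + (Finset.univ.filter (· ∈ Y)).card := by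
    have := Finset.card_filter_add_card_filter_not (s := (Finset.univ : Finset V)) (· ∈ X)
    rw [Finset.card_univ] at this
    simp only [pY]
    exact this.symm
  generalize (Finset.univ.filter (· ∈ X)).card = p at *
  generalize (Finset.univ.filter (· ∈ Y)).card = q at *
  have hch : q * (q - 1) = 2 * q.choose 2 := by
    rw [Nat.choose_two_right, Nat.mul_div_cancel' (Nat.even_mul_pred_self q).two_dvd]
  obtain ⟨r, rfl⟩ := Nat.exists_eq_add_of_le hq
  have e : 4 + r - 1 = 3 + r := by omega
  rw [e] at hch
  nlinarith

end BT

theorem stmt18 {V : Type*} [Fintype V] [Nontrivial V] (A : V → V → Prop)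
    (X Y : Set V)
    (hpart : ∀ v : V, (v ∈ X ∧ v ∉ Y) ∨ (v ∈ Y ∧ v ∉ X))
    (hanti : ∀ u v : V, ¬ (A u v ∧ A v u))
    (hadj : ∀ u v : V, (A u v ∨ A v u) ↔ ((u ∈ X ∧ v ∈ Y) ∨ (u ∈ Y ∧ v ∈ X)))
    (hdiam : ∀ u v : V, ∃ n : ℕ, n ≤ 3 ∧ stepsTo A n u v) :
    (Set.univ : Set V) ∈ lineSet A ∨ Fintype.card V ≤ (lineSet A).ncard := by
  have h : BT A X Y := ⟨hpart, hanti, hadj, hdiam⟩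
  rcases le_total (Finset.univ.filter (· ∈ X)).card (Finset.univ.filter (· ∈ Y)).card with hc | hc
  · exact h.main hc
  · exact h.swap.main hc
end

section
/- Every strongly connected oriented graph D on at most five vertices either has the full vertex set as a line or has at least |V(D)| distinct lines. -/
open scoped Classical

/-- Evaluate a natural number before passing it on (helps kernel evaluation). -/
def forceNat {α : Type} (n : ℕ) (k : ℕ → α) : α :=
  Nat.casesOn n (k 0) (fun m => k (Nat.succ m))

/-- Bit test written with kernel-accelerated primitives. -/
def bt (m i : ℕ) : Bool := Nat.beq (Nat.land 1 (Nat.shiftRight m i)) 1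

/-- Continuation-passing `List.map` that evaluates the entries. -/
def mapK (g : ℕ → ℕ) : List ℕ → (List ℕ → Bool) → Bool
  | [], k => k []
  | x :: xs, k => forceNat (g x) fun y => mapK g xs fun ys => k (y :: ys)

/-- `L[i]`, default `0`. -/
def gt0 : List ℕ → ℕ → ℕ
  | [], _ => 0
  | x :: xs, i => Nat.casesOn i x (fun j => gt0 xs j)

/-- Union of the masks `L[w]` over the out-neighbours `w` of `u` among `ws`. -/
def orRow (M : ℕ) (L : List ℕ) (u : ℕ) : List ℕ → ℕ
  | [] => 0
  | w :: ws => cond (bt M (Nat.add (Nat.mul 5 u) w)) (Nat.lor (gt0 L w) (orRow M L u ws))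
      (orRow M L u ws)

/-- One step of the ball recursion. -/
def ballStep (M : ℕ) (R L : List ℕ) (u : ℕ) : ℕ :=
  Nat.lor (Nat.shiftLeft 1 u) (orRow M L u R)

/-- Pass the list of ball lists of radius `k - 1, ..., 0` (in front of `Ls`) to `c`,
starting from the current ball list `L`. -/
def ballsK (M : ℕ) (R : List ℕ) (c : List (List ℕ) → List ℕ → Bool) :
    ℕ → List (List ℕ) → List ℕ → Bool
  | 0, Ls, L => c Ls L
  | k + 1, Ls, L => mapK (ballStep M R L) R fun L' => ballsK M R c k (L :: Ls) L'

/-- number of balls around `u` that miss `v` -/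
def cnt (u v : ℕ) : List (List ℕ) → ℕ
  | [] => 0
  | L :: Ls => cond (bt (gt0 L u) v) (cnt u v Ls) (Nat.succ (cnt u v Ls))

/-- the distance table looked up -/
def dT (T : List ℕ) (u v : ℕ) : ℕ := gt0 T (Nat.add (Nat.mul 5 u) v)

/-- is `z` on the line of `u v` -/
def inL (T : List ℕ) (u v z : ℕ) : Bool :=
  or (Nat.beq (dT T z v) (Nat.add (dT T z u) (dT T u v)))
    (or (Nat.beq (dT T u z) (Nat.add (dT T u v) (dT T v z)))
      (Nat.beq (dT T u v) (Nat.add (dT T u z) (dT T z v))))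

/-- mask of a Boolean function -/
def maskOf (p : ℕ → Bool) : List ℕ → ℕ
  | [] => 0
  | z :: zs => cond (p z) (Nat.succ (Nat.mul 2 (maskOf p zs))) (Nat.mul 2 (maskOf p zs))

/-- main test on the distance table -/
def testT (n : ℕ) (R : List ℕ) (P : List (ℕ × ℕ)) (T : List ℕ) : Bool :=
  or (P.any fun p => R.all fun z => inL T p.1 p.2 z)
    (Nat.ble n (P.map fun p => maskOf (inL T p.1 p.2) R).dedup.length)

/-- test of one graph -/
def testM (n : ℕ) (R J : List ℕ) (P : List (ℕ × ℕ)) (M : ℕ) : Bool :=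
  mapK (fun u => Nat.shiftLeft 1 u) R fun L0 =>
  ballsK M R (fun Ls L =>
    and (L.all fun b => Nat.beq b (Nat.pred (Nat.shiftLeft 1 n)))
      (mapK (fun j => cnt (Nat.div j 5) (Nat.mod j 5) Ls) J (testT n R P))) (Nat.pred n) [] L0

/-- does some cut have no arc -/
def noCut (U : ℕ) : List ℕ → Bool
  | [] => false
  | m :: ms => Nat.casesOn (Nat.land U m) true fun _ => noCut U ms

/-- exhaustive search over all orientations of the pairs of positions in the list -/
def search (t : ℕ → Bool) (cs : List ℕ) : List (ℕ × ℕ) → ℕ → Bool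
  | [], U => cond (noCut U cs) true (t U)
  | p :: ps, U => cond (noCut U cs) true
      (and (forceNat (Nat.xor U (Nat.shiftLeft 1 p.1)) (search t cs ps))
      (and (forceNat (Nat.xor U (Nat.shiftLeft 1 p.2)) (search t cs ps))
        (forceNat (Nat.xor (Nat.xor U (Nat.shiftLeft 1 p.1)) (Nat.shiftLeft 1 p.2))
          (search t cs ps))))

/-- indices of vertices -/
def R3 : List ℕ := [0, 1, 2]
/-- indices of vertices -/
def R4 : List ℕ := [0, 1, 2, 3]
/-- indices of vertices -/
def R5 : List ℕ := [0, 1, 2, 3, 4]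
/-- indices of table entries -/
def J25 : List ℕ :=
  [0, 1, 2, 3, 4, 5, 6, 7, 8, 9, 10, 11, 12, 13, 14, 15, 16, 17, 18, 19, 20, 21, 22, 23, 24]
/-- pairs of vertices -/
def P3 : List (ℕ × ℕ) := [(0, 1), (0, 2), (1, 0), (1, 2), (2, 0), (2, 1)]
/-- pairs of vertices -/
def P4 : List (ℕ × ℕ) :=
  [(0, 1), (0, 2), (0, 3), (1, 0), (1, 2), (1, 3), (2, 0), (2, 1), (2, 3), (3, 0), (3, 1), (3, 2)]
/-- pairs of vertices -/
def P5 : List (ℕ × ℕ) :=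
  [(0, 1), (0, 2), (0, 3), (0, 4), (1, 0), (1, 2), (1, 3), (1, 4), (2, 0), (2, 1), (2, 3), (2, 4),
   (3, 0), (3, 1), (3, 2), (3, 4), (4, 0), (4, 1), (4, 2), (4, 3)]
/-- free pairs of positions -/
def F3 : List (ℕ × ℕ) := [(2, 10)]
/-- free pairs of positions -/
def F4 : List (ℕ × ℕ) := [(8, 16), (3, 15), (2, 10)]
/-- free pairs of positions -/
def F5 : List (ℕ × ℕ) := [(19, 23), (14, 22), (9, 21), (4, 20), (8, 16), (3, 15), (2, 10)]
/-- cut masks -/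
def C3 : List ℕ := [6, 160, 132, 3072, 2050, 1056]
/-- cut masks -/
def C4 : List ℕ :=
  [14, 416, 11264, 8456, 229376, 131204, 67586, 33824, 396, 10250, 9504, 196614, 164000,
   101376]
/-- cut masks -/
def C5 : List ℕ :=
  [30, 928, 27648, 753664, 541200, 15728640, 8397064, 4325508, 2164738, 1082400, 924,
   26650, 26400, 25368, 720918, 688800, 656020, 642048, 608274, 575008, 14680078,
   13631904, 12583308, 11545600, 10496010, 9446688, 7569408, 6488070, 5406880, 3247104]

theorem run3 : search (testM 3 R3 J25 P3) C3 F3 1158 = true := by decide +kernel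
theorem run4 : search (testM 4 R4 J25 P4) C4 F4 107918 = true := by decide +kernel
set_option maxRecDepth 100000 in
theorem run5 : search (testM 5 R5 J25 P5) C5 F5 16377758 = true := by decide +kernel

theorem bt_eq (m i : ℕ) : bt m i = m.testBit i := by
  have h : (1 : ℕ) &&& (m >>> i) = (m >>> i) % 2 := by
    rw [Nat.and_comm, Nat.and_one_is_mod]
  have h2 : bt m i = Nat.beq (1 &&& (m >>> i)) 1 := rfl
  rw [h2, Nat.testBit_eq_decide_div_mod_eq, h, Nat.shiftRight_eq_div_pow, Bool.eq_iff_iff, Nat.beq_eq,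
    decide_eq_true_eq]

theorem forceNat_eq {α : Type} (n : ℕ) (k : ℕ → α) : forceNat n k = k n := by
  cases n <;> rfl

theorem mapK_eq (g : ℕ → ℕ) (xs : List ℕ) (k : List ℕ → Bool) :
    mapK g xs k = k (xs.map g) := by
  induction xs generalizing k with
  | nil => rfl
  | cons x xs ih => simp [mapK, forceNat_eq, ih]

theorem gt0_eq (L : List ℕ) (i : ℕ) : gt0 L i = L.getD i 0 := by
  induction L generalizing i with
  | nil => rfl
  | cons x xs ih => cases i with
    | zero => rfl
    | succ j => simpa [gt0] using ih j

theorem gt0_map_range (g : ℕ → ℕ) (n i : ℕ) (h : i < n) :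
    gt0 ((List.range n).map g) i = g i := by
  rw [gt0_eq]; simp [h]

theorem orRow_bit (M : ℕ) (L : List ℕ) (u v : ℕ) (ws : List ℕ) :
    (orRow M L u ws).testBit v = true ↔
      ∃ w ∈ ws, bt M (5 * u + w) = true ∧ bt (gt0 L w) v = true := by
  induction ws with
  | nil => simp [orRow]
  | cons w ws ih =>
    have e : orRow M L u (w :: ws) = cond (bt M (5 * u + w)) (gt0 L w ||| orRow M L u ws)
      (orRow M L u ws) := rfl
    rw [e]
    rw [List.exists_mem_cons_iff, ← ih]
    cases hb : bt M (5 * u + w) <;> simp [Nat.testBit_or, bt_eq]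

theorem ballStep_bit (M : ℕ) (L R : List ℕ) (u v : ℕ) :
    bt (ballStep M R L u) v = true ↔
      u = v ∨ ∃ w ∈ R, bt M (5 * u + w) = true ∧ bt (gt0 L w) v = true := by
  have e : ballStep M R L u = (1 <<< u) ||| orRow M L u R := rfl
  rw [e, bt_eq, Nat.testBit_or, Bool.or_eq_true, orRow_bit, Nat.one_shiftLeft,
    Nat.testBit_two_pow]
  simp

section graph
variable {V : Type*} {A : V → V → Prop}

theorem ddist_steps (hsc : StronglyConnected A) (u v : V) : stepsTo A (ddist A u v) u v :=
  Nat.sInf_mem (s := {n : ℕ | stepsTo A n u v}) (hsc u v)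

theorem ddist_le {n : ℕ} {u v : V} (h : stepsTo A n u v) : ddist A u v ≤ n :=
  Nat.sInf_le h

theorem ddist_le_zero (hsc : StronglyConnected A) (u v : V) : ddist A u v ≤ 0 ↔ u = v := by
  constructor
  · intro h
    have := ddist_steps hsc u v
    rw [Nat.le_zero.1 h] at this
    exact this
  · intro h
    exact ddist_le (n := 0) h

theorem ddist_le_succ (hsc : StronglyConnected A) (u v : V) (k : ℕ) :
    ddist A u v ≤ k + 1 ↔ u = v ∨ ∃ w, A u w ∧ ddist A w v ≤ k := by
  constructor
  · intro h
    have h1 := ddist_steps hsc u v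
    cases hd : ddist A u v with
    | zero => rw [hd] at h1; exact Or.inl h1
    | succ m =>
      rw [hd] at h1
      obtain ⟨w, hw, h2⟩ := h1
      exact Or.inr ⟨w, hw, (ddist_le h2).trans (by omega)⟩
  · rintro (h | ⟨w, hw, h⟩)
    · exact ((ddist_le_zero hsc u v).2 h).trans (Nat.zero_le _)
    · have : ddist A u v ≤ ddist A w v + 1 := ddist_le ⟨w, hw, ddist_steps hsc w v⟩
      omega

theorem exists_arc_out (Q : V → Prop) (n : ℕ) (u v : V) (h : stepsTo A n u v) (hu : Q u)
    (hv : ¬ Q v) : ∃ a b, A a b ∧ Q a ∧ ¬ Q b := by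
  induction n generalizing u with
  | zero => exact absurd (show u = v from h ▸ rfl) (fun e => hv (e ▸ hu))
  | succ n ih =>
    obtain ⟨w, hw, h2⟩ := h
    by_cases hq : Q w
    · exact ih w h2 hq
    · exact ⟨u, w, hw, hu, hq⟩

/-- `f` enumerates the vertices by the indices below `n`, and `M` codes the arcs. -/
structure Coded (A : V → V → Prop) (n : ℕ) (f : ℕ → V) (M : ℕ) : Prop where
  sc : StronglyConnected A
  n5 : n ≤ 5
  surj : ∀ v, ∃ i < n, f i = v
  inj : ∀ i < n, ∀ j < n, f i = f j → i = j
  bit : ∀ i < n, ∀ j < n, (bt M (5 * i + j) = true ↔ A (f i) (f j))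

variable {n M : ℕ} {f : ℕ → V}

/-- `L` lists the balls of radius `k`. -/
def IsBall (A : V → V → Prop) (n : ℕ) (f : ℕ → V) (k : ℕ) (L : List ℕ) : Prop :=
  L.length = n ∧ ∀ u < n, ∀ v < n, (bt (gt0 L u) v = true ↔ ddist A (f u) (f v) ≤ k)

theorem isBall_zero (H : Coded A n f M) :
    IsBall A n f 0 ((List.range n).map fun u => Nat.shiftLeft 1 u) := by
  refine ⟨by simp, fun u hu v hv => ?_⟩
  rw [gt0_map_range _ _ _ hu, ddist_le_zero H.sc, bt_eq]
  have e : Nat.shiftLeft 1 u = 1 <<< u := rfl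
  rw [e, Nat.one_shiftLeft, Nat.testBit_two_pow]
  simp only [decide_eq_true_eq]
  exact ⟨fun h => h ▸ rfl, H.inj u hu v hv⟩

theorem isBall_succ (H : Coded A n f M) {k : ℕ} {L : List ℕ} (h : IsBall A n f k L) :
    IsBall A n f (k + 1) ((List.range n).map (ballStep M (List.range n) L)) := by
  refine ⟨by simp, fun u hu v hv => ?_⟩
  rw [gt0_map_range _ _ _ hu, ddist_le_succ H.sc, ballStep_bit]
  apply or_congr
  · exact ⟨fun h => h ▸ rfl, H.inj u hu v hv⟩
  · constructor
    · rintro ⟨w, hw, h1, h2⟩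
      have hw := List.mem_range.1 hw
      exact ⟨f w, (H.bit u hu w hw).1 h1, (h.2 w hw v hv).1 h2⟩
    · rintro ⟨x, h1, h2⟩
      obtain ⟨w, hw, rfl⟩ := H.surj x
      exact ⟨w, List.mem_range.2 hw, (H.bit u hu w hw).2 h1, (h.2 w hw v hv).2 h2⟩

theorem ballsK_sound (H : Coded A n f M) (c : List (List ℕ) → List ℕ → Bool) (k m : ℕ)
    (Ls : List (List ℕ)) (L : List ℕ) (hL : IsBall A n f m L)
    (hLs : ∀ u < n, ∀ v < n, cnt u v Ls = min m (ddist A (f u) (f v)))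
    (h : ballsK M (List.range n) c k Ls L = true) :
    ∃ Ls' L', c Ls' L' = true ∧ IsBall A n f (m + k) L' ∧
      ∀ u < n, ∀ v < n, cnt u v Ls' = min (m + k) (ddist A (f u) (f v)) := by
  induction k generalizing m Ls L with
  | zero => exact ⟨Ls, L, h, hL, hLs⟩
  | succ k ih =>
    rw [ballsK, mapK_eq] at h
    have := ih (m + 1) (L :: Ls) _ (isBall_succ H hL) (fun u hu v hv => by
      rw [cnt, hLs u hu v hv]
      have hb := hL.2 u hu v hv
      cases hh : bt (gt0 L u) v
      · have : ¬ ddist A (f u) (f v) ≤ m := fun h => by simp [hb.2 h] at hh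
        simp only [cond_false]; omega
      · have := hb.1 hh
        simp only [cond_true]; omega) h
    rwa [show m + 1 + k = m + (k + 1) by omega] at this

theorem inL_iff (T : List ℕ) (hT : ∀ u < n, ∀ v < n, dT T u v = ddist A (f u) (f v))
    (u v z : ℕ) (hu : u < n) (hv : v < n) (hz : z < n) :
    inL T u v z = true ↔ f z ∈ line A (f u) (f v) := by
  simp only [inL, Bool.or_eq_true, Nat.beq_eq, line, Set.mem_ofPred_eq, _root_.btw, Nat.add_eq]
  rw [hT z hz v hv, hT z hz u hu, hT u hu v hv, hT u hu z hz, hT v hv z hz]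

theorem maskOf_congr (p q : ℕ → Bool) (zs : List ℕ) (h : ∀ z ∈ zs, p z = q z) :
    maskOf p zs = maskOf q zs := by
  induction zs with
  | nil => rfl
  | cons z zs ih =>
    rw [maskOf, maskOf, h z (by simp), ih fun z hz => h z (by simp [hz])]

theorem testT_sound [Finite V] (H : Coded A n f M) (P : List (ℕ × ℕ))
    (hP : ∀ p ∈ P, p.1 < n ∧ p.2 < n ∧ p.1 ≠ p.2) (T : List ℕ)
    (hT : ∀ u < n, ∀ v < n, dT T u v = ddist A (f u) (f v))
    (h : testT n (List.range n) P T = true) :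
    Set.univ ∈ lineSet A ∨ n ≤ (lineSet A).ncard := by
  rw [testT, Bool.or_eq_true] at h
  rcases h with h | h
  · left
    rw [List.any_eq_true] at h
    obtain ⟨p, hp, h⟩ := h
    obtain ⟨h1, h2, h3⟩ := hP p hp
    refine ⟨f p.1, f p.2, fun e => h3 (H.inj _ h1 _ h2 e), ?_⟩
    symm
    rw [Set.eq_univ_iff_forall]
    intro x
    obtain ⟨z, hz, rfl⟩ := H.surj x
    rw [List.all_eq_true] at h
    exact (inL_iff T hT _ _ _ h1 h2 hz).1 (h z (List.mem_range.2 hz))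
  · right
    have h := Nat.le_of_ble_eq_true h
    let g : Set V → ℕ := fun S => maskOf (fun i => decide (f i ∈ S)) (List.range n)
    set l := P.map fun p => maskOf (inL T p.1 p.2) (List.range n) with hl
    have hsub : (l.toFinset : Set ℕ) ⊆ Set.image g (lineSet A) := by
      intro m hm
      simp only [List.coe_toFinset, Set.mem_ofPred_eq, hl, List.mem_map] at hm
      obtain ⟨p, hp, rfl⟩ := hm
      obtain ⟨h1, h2, h3⟩ := hP p hp
      refine ⟨line A (f p.1) (f p.2), ⟨_, _, fun e => h3 (H.inj _ h1 _ h2 e), rfl⟩, ?_⟩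
      apply maskOf_congr
      intro z hz
      have := inL_iff T hT _ _ _ h1 h2 (List.mem_range.1 hz)
      rw [Bool.eq_iff_iff, this]
      simp
    have h1 : (l.toFinset : Set ℕ).ncard ≤ (Set.image g (lineSet A)).ncard :=
      Set.ncard_le_ncard hsub (Set.toFinite _)
    rw [Set.ncard_coe_finset, List.card_toFinset] at h1
    have h2 : (Set.image g (lineSet A)).ncard ≤ (lineSet A).ncard := Set.ncard_image_le (Set.toFinite _)
    exact h.trans (h1.trans h2)

theorem testM_sound [Finite V] (H : Coded A n f M) (P : List (ℕ × ℕ))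
    (hP : ∀ p ∈ P, p.1 < n ∧ p.2 < n ∧ p.1 ≠ p.2)
    (h : testM n (List.range n) (List.range 25) P M = true) :
    Set.univ ∈ lineSet A ∨ n ≤ (lineSet A).ncard := by
  rw [testM, mapK_eq] at h
  obtain ⟨Ls, L, hc, hL, hcnt⟩ := ballsK_sound H _ _ 0 _ _ (isBall_zero H)
    (fun u hu v hv => by simp [cnt]) h
  rw [Bool.and_eq_true, List.all_eq_true, mapK_eq] at hc
  obtain ⟨hall, ht⟩ := hc
  refine testT_sound H P hP _ ?_ ht
  intro u hu v hv
  have n5 := H.n5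
  have e1 : dT ((List.range 25).map fun j => cnt (Nat.div j 5) (Nat.mod j 5) Ls) u v
      = cnt u v Ls := by
    have hlt : 5 * u + v < 25 := by omega
    have : dT ((List.range 25).map fun j => cnt (Nat.div j 5) (Nat.mod j 5) Ls) u v
      = cnt ((5 * u + v) / 5) ((5 * u + v) % 5) Ls := gt0_map_range _ _ _ hlt
    rw [this, show (5 * u + v) / 5 = u by omega, show (5 * u + v) % 5 = v by omega]
  rw [e1, hcnt u hu v hv]
  have hb : bt (gt0 L u) v = true := by
    have hu' : u < L.length := by rw [hL.1]; exact hu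
    have hg : gt0 L u = L[u] := by rw [gt0_eq]; simp [hu']
    have h2 := Nat.eq_of_beq_eq_true (hall L[u] (List.getElem_mem hu'))
    have h3 : Nat.pred (Nat.shiftLeft 1 n) = 2 ^ n - 1 := by
      rw [← Nat.one_shiftLeft]; rfl
    rw [bt_eq, hg, h2, h3, Nat.testBit_two_pow_sub_one]
    simpa using hv
  have := (hL.2 u hu v hv).1 hb
  omega

end graph

theorem noCut_sound (U M : ℕ) (hsub : ∀ k, M.testBit k = true → U.testBit k = true)
    (cs : List ℕ) (hc : ∀ m ∈ cs, ∃ k, M.testBit k = true ∧ m.testBit k = true) :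
    noCut U cs = false := by
  induction cs with
  | nil => rfl
  | cons m ms ih =>
    obtain ⟨k, h1, h2⟩ := hc m (by simp)
    have e : noCut U (m :: ms) = Nat.casesOn (U &&& m) true fun _ => noCut U ms := rfl
    rw [e]
    cases hx : U &&& m with
    | zero =>
      have : (U &&& m).testBit k = true := by rw [Nat.testBit_and, hsub k h1, h2]; rfl
      rw [hx] at this
      simp at this
    | succ j => exact ih fun m hm => hc m (by simp [hm])

/-- all positions in a list of pairs -/
def flat (ps : List (ℕ × ℕ)) : List ℕ := ps.flatMap fun p => [p.1, p.2]

theorem search_sound (t : ℕ → Bool) (cs : List ℕ) (M : ℕ)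
    (hc : ∀ m ∈ cs, ∃ k, M.testBit k = true ∧ m.testBit k = true)
    (ps : List (ℕ × ℕ)) (U : ℕ) (hnd : (flat ps).Nodup)
    (h1 : ∀ k, k ∉ flat ps → M.testBit k = U.testBit k)
    (h2 : ∀ k ∈ flat ps, U.testBit k = true)
    (hor : ∀ p ∈ ps, ¬ (M.testBit p.1 = true ∧ M.testBit p.2 = true))
    (h : search t cs ps U = true) : t M = true := by
  have hcut : noCut U cs = false := by
    apply noCut_sound U M _ cs hc
    intro k hk
    by_cases hkf : k ∈ flat ps
    · exact h2 k hkf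
    · rw [← h1 k hkf, hk]
  induction ps generalizing U with
  | nil =>
    have : M = U := Nat.eq_of_testBit_eq fun k => h1 k (by simp [flat])
    subst this
    rw [search, hcut] at h
    exact h
  | cons p ps ih =>
    obtain ⟨a, b⟩ := p
    have hflat : flat ((a, b) :: ps) = a :: b :: flat ps := by simp [flat]
    rw [hflat] at hnd h1 h2
    simp only [List.nodup_cons, List.mem_cons, not_or] at hnd h1 h2
    obtain ⟨⟨hab, ha⟩, hb, hnd⟩ := hnd
    have ho := hor (a, b) (by simp)
    simp only at ho
    rw [search, hcut] at h
    simp only [forceNat_eq, cond_false, Bool.and_eq_true] at h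
    have key : ∀ U', (∀ k, k ≠ a → k ≠ b → U'.testBit k = U.testBit k) →
        U'.testBit a = M.testBit a → U'.testBit b = M.testBit b →
        search t cs ps U' = true → t M = true := by
      intro U' hU ea eb hs
      have g1 : ∀ k, k ∉ flat ps → M.testBit k = U'.testBit k := by
        intro k hk
        by_cases hka : k = a
        · rw [hka, ea]
        by_cases hkb : k = b
        · rw [hkb, eb]
        rw [hU k hka hkb, h1 k ⟨hka, hkb, hk⟩]
      have g2 : ∀ k ∈ flat ps, U'.testBit k = true := by
        intro k hk
        rw [hU k (fun e => ha (e ▸ hk)) (fun e => hb (e ▸ hk))]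
        exact h2 k (Or.inr (Or.inr hk))
      refine ih U' hnd g1 g2 (fun p hp => hor p (by simp [hp])) hs ?_
      apply noCut_sound U' M _ cs hc
      intro k hk
      by_cases hkf : k ∈ flat ps
      · exact g2 k hkf
      · rw [← g1 k hkf, hk]
    have e : ∀ U k, Nat.xor U (Nat.shiftLeft 1 k) = U ^^^ 2 ^ k := by
      intro U k
      rw [← Nat.one_shiftLeft]; rfl
    simp only [e] at h
    have ua := h2 a (Or.inl rfl)
    have ub := h2 b (Or.inr (Or.inl rfl))
    obtain ⟨s1, s2, s3⟩ := h
    have hba : b ≠ a := fun e => hab e.symm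
    cases ma : M.testBit a <;> cases mb : M.testBit b
    · refine key _ ?_ ?_ ?_ s3
      · intro k h1 h2
        simp [Nat.testBit_xor, h1.symm, h2.symm]
      · simp [Nat.testBit_xor, ua, ma, hba]
      · simp [Nat.testBit_xor, ub, mb, hab]
    · refine key _ ?_ ?_ ?_ s1
      · intro k h1 h2
        simp [Nat.testBit_xor, h1.symm]
      · simp [Nat.testBit_xor, ua, ma]
      · simp [Nat.testBit_xor, ub, mb, hab]
    · refine key _ ?_ ?_ ?_ s2
      · intro k h1 h2
        simp [Nat.testBit_xor, h2.symm]
      · simp [Nat.testBit_xor, ua, ma, hba]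
      · simp [Nat.testBit_xor, ub, mb]
    · exact absurd ⟨ma, mb⟩ ho

/-- every mask of the list contains a full cut -/
def CutsOK (n : ℕ) (cs : List ℕ) : Prop :=
  ∀ m ∈ cs, ∃ S < 2 ^ n, (∃ i < n, S.testBit i = true) ∧ (∃ j < n, S.testBit j = false) ∧
    ∀ i < n, ∀ j < n, S.testBit i = true → S.testBit j = false → m.testBit (5 * i + j) = true

theorem cuts3 : CutsOK 3 C3 := by unfold CutsOK; decide +kernel
theorem cuts4 : CutsOK 4 C4 := by unfold CutsOK; decide +kernel
theorem cuts5 : CutsOK 5 C5 := by unfold CutsOK; decide +kernel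

section graph2
variable {V : Type*} {A : V → V → Prop} {n : ℕ} {f : ℕ → V}

theorem cuts_meet {M : ℕ} (H : Coded A n f M) (cs : List ℕ) (hcs : CutsOK n cs) :
    ∀ m ∈ cs, ∃ k, M.testBit k = true ∧ m.testBit k = true := by
  intro m hm
  obtain ⟨S, -, ⟨i, hi, hSi⟩, ⟨j, hj, hSj⟩, hS⟩ := hcs m hm
  obtain ⟨r, hr⟩ := H.sc (f i) (f j)
  obtain ⟨a, b, hab, ⟨i', hi', hSi', rfl⟩, hb⟩ := exists_arc_out
    (fun x => ∃ i < n, S.testBit i = true ∧ f i = x) r _ _ hr ⟨i, hi, hSi, rfl⟩ (by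
      rintro ⟨j', hj', hSj', e⟩
      rw [H.inj _ hj' _ hj e, hSj] at hSj'
      exact absurd hSj' (by simp))
  obtain ⟨j', hj', rfl⟩ := H.surj b
  refine ⟨5 * i' + j', ?_, hS i' hi' j' hj' hSi' ?_⟩
  · rw [← bt_eq]; exact (H.bit i' hi' j' hj').2 hab
  · cases h : S.testBit j'
    · rfl
    · exact absurd ⟨j', hj', h, rfl⟩ hb

/-- code of a graph -/
noncomputable def code (A : V → V → Prop) (n : ℕ) (f : ℕ → V) : ℕ :=
  Nat.ofBits (fun k : Fin 25 =>
    decide (k.1 / 5 < n ∧ k.1 % 5 < n ∧ A (f (k.1 / 5)) (f (k.1 % 5))))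

theorem code_bit (k : ℕ) : (code A n f).testBit k =
    decide (k < 25 ∧ k / 5 < n ∧ k % 5 < n ∧ A (f (k / 5)) (f (k % 5))) := by
  by_cases hk : k < 25
  · rw [code, Nat.testBit_ofBits_lt _ _ hk]; simp [hk]
  · rw [code, Nat.testBit_ofBits_ge _ _ (by omega)]; simp [hk]

theorem coded_code (hsc : StronglyConnected A) (n5 : n ≤ 5) (hs : ∀ v, ∃ i < n, f i = v)
    (hi : ∀ i < n, ∀ j < n, f i = f j → i = j) : Coded A n f (code A n f) := by
  refine ⟨hsc, n5, hs, hi, fun i hi j hj => ?_⟩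
  rw [bt_eq, code_bit, show (5 * i + j) / 5 = i by omega, show (5 * i + j) % 5 = j by omega,
    decide_eq_true_eq]
  exact ⟨fun h => h.2.2.2, fun h => ⟨by omega, hi, hj, h⟩⟩

theorem final3 [Finite V] (hanti : ∀ u v : V, ¬ (A u v ∧ A v u)) (hsc : StronglyConnected A)
    (hs : ∀ v, ∃ i < 3, f i = v) (hi : ∀ i < 3, ∀ j < 3, f i = f j → i = j)
    (h01 : A (f 0) (f 1)) (h12 : A (f 1) (f 2)) :
    Set.univ ∈ lineSet A ∨ 3 ≤ (lineSet A).ncard := by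
  have H := coded_code hsc (by norm_num) hs hi
  have h10 : ¬ A (f 1) (f 0) := fun h => hanti _ _ ⟨h01, h⟩
  have h21 : ¬ A (f 2) (f 1) := fun h => hanti _ _ ⟨h12, h⟩
  have hirr : ∀ x, ¬ A x x := fun x h => hanti _ _ ⟨h, h⟩
  refine testM_sound H P3 (by decide) (search_sound _ C3 _ (cuts_meet H _ cuts3) F3 _
    (by decide) ?_ (by decide) ?_ run3)
  · intro k hk
    rw [code_bit]
    by_cases hk25 : k < 25
    · interval_cases k <;> simp [F3, flat] at hk <;> simp [h01, h12, h10, h21, hirr, Nat.testBit]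
    · rw [Nat.testBit_lt_two_pow (lt_of_lt_of_le (by norm_num : _ < 2 ^ 25)
        (Nat.pow_le_pow_right (by norm_num) (not_lt.1 hk25)))]
      simp [hk25]
  · simp only [code_bit, F3]
    simp
    exact fun h1 h2 => hanti _ _ ⟨h1, h2⟩

theorem final4 [Finite V] (hanti : ∀ u v : V, ¬ (A u v ∧ A v u)) (hsc : StronglyConnected A)
    (hs : ∀ v, ∃ i < 4, f i = v) (hi : ∀ i < 4, ∀ j < 4, f i = f j → i = j)
    (h01 : A (f 0) (f 1)) (h12 : A (f 1) (f 2)) (h23 : A (f 2) (f 3)) :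
    Set.univ ∈ lineSet A ∨ 4 ≤ (lineSet A).ncard := by
  have H := coded_code hsc (by norm_num) hs hi
  have h10 : ¬ A (f 1) (f 0) := fun h => hanti _ _ ⟨h01, h⟩
  have h21 : ¬ A (f 2) (f 1) := fun h => hanti _ _ ⟨h12, h⟩
  have h32 : ¬ A (f 3) (f 2) := fun h => hanti _ _ ⟨h23, h⟩
  have hirr : ∀ x, ¬ A x x := fun x h => hanti _ _ ⟨h, h⟩
  refine testM_sound H P4 (by decide) (search_sound _ C4 _ (cuts_meet H _ cuts4) F4 _
    (by decide) ?_ (by decide) ?_ run4)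
  · intro k hk
    rw [code_bit]
    by_cases hk25 : k < 25
    · interval_cases k <;> simp [F4, flat] at hk <;>
        simp [h01, h12, h23, h10, h21, h32, hirr, Nat.testBit]
    · rw [Nat.testBit_lt_two_pow (lt_of_lt_of_le (by norm_num : _ < 2 ^ 25)
        (Nat.pow_le_pow_right (by norm_num) (not_lt.1 hk25)))]
      simp [hk25]
  · simp only [code_bit, F4]
    simp
    exact ⟨fun h1 h2 => hanti _ _ ⟨h1, h2⟩, fun h1 h2 => hanti _ _ ⟨h1, h2⟩,
      fun h1 h2 => hanti _ _ ⟨h1, h2⟩⟩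

theorem final5 [Finite V] (hanti : ∀ u v : V, ¬ (A u v ∧ A v u)) (hsc : StronglyConnected A)
    (hs : ∀ v, ∃ i < 5, f i = v) (hi : ∀ i < 5, ∀ j < 5, f i = f j → i = j)
    (h01 : A (f 0) (f 1)) (h12 : A (f 1) (f 2)) (h23 : A (f 2) (f 3)) :
    Set.univ ∈ lineSet A ∨ 5 ≤ (lineSet A).ncard := by
  have H := coded_code hsc (by norm_num) hs hi
  have h10 : ¬ A (f 1) (f 0) := fun h => hanti _ _ ⟨h01, h⟩
  have h21 : ¬ A (f 2) (f 1) := fun h => hanti _ _ ⟨h12, h⟩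
  have h32 : ¬ A (f 3) (f 2) := fun h => hanti _ _ ⟨h23, h⟩
  have hirr : ∀ x, ¬ A x x := fun x h => hanti _ _ ⟨h, h⟩
  refine testM_sound H P5 (by decide) (search_sound _ C5 _ (cuts_meet H _ cuts5) F5 _
    (by decide) ?_ (by decide) ?_ run5)
  · intro k hk
    rw [code_bit]
    by_cases hk25 : k < 25
    · interval_cases k <;> simp [F5, flat] at hk <;>
        simp [h01, h12, h23, h10, h21, h32, hirr, Nat.testBit]
    · rw [Nat.testBit_lt_two_pow (lt_of_lt_of_le (by norm_num : _ < 2 ^ 25)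
        (Nat.pow_le_pow_right (by norm_num) (not_lt.1 hk25)))]
      simp [hk25]
  · simp only [code_bit, F5]
    simp
    exact ⟨fun h1 h2 => hanti _ _ ⟨h1, h2⟩, fun h1 h2 => hanti _ _ ⟨h1, h2⟩,
      fun h1 h2 => hanti _ _ ⟨h1, h2⟩, fun h1 h2 => hanti _ _ ⟨h1, h2⟩,
      fun h1 h2 => hanti _ _ ⟨h1, h2⟩, fun h1 h2 => hanti _ _ ⟨h1, h2⟩,
      fun h1 h2 => hanti _ _ ⟨h1, h2⟩⟩

/-- A duplicate-free list extends to an enumeration of the vertices. -/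
theorem exists_enum [Fintype V] (l : List V) (hl : l.Nodup) (x : V) :
    ∃ f : ℕ → V, (∀ i < l.length, f i = l.getD i x) ∧ (∀ v, ∃ i < Fintype.card V, f i = v) ∧
      ∀ i < Fintype.card V, ∀ j < Fintype.card V, f i = f j → i = j := by
  set l' := l ++ (Finset.univ \ l.toFinset).toList with hl'
  have hnd : l'.Nodup := by
    rw [hl', List.nodup_append']
    refine ⟨hl, Finset.nodup_toList _, ?_⟩
    intro a ha hb
    simp at hb
    exact hb ha
  have hmem : ∀ v, v ∈ l' := by
    intro v
    by_cases h : v ∈ l <;> simp [hl', h]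
  have hlen : l'.length = Fintype.card V := by
    rw [← List.toFinset_card_of_nodup hnd, ← Finset.card_univ]
    congr 1
    ext v
    simp [hmem v]
  refine ⟨fun i => l'.getD i x, ?_, ?_, ?_⟩
  · intro i hi
    simp [hl', List.getElem?_append_left hi]
  · intro v
    obtain ⟨i, hi, e⟩ := List.getElem_of_mem (hmem v)
    exact ⟨i, hlen ▸ hi, by simp [hi, e]⟩
  · intro i hi j hj e
    rw [← hlen] at hi hj
    simp only [List.getD_eq_getElem _ _ hi, List.getD_eq_getElem _ _ hj] at e
    exact (hnd.getElem_inj_iff).1 e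

theorem exists_out [Nontrivial V] (hsc : StronglyConnected A) (u : V) : ∃ w, A u w := by
  obtain ⟨v, hv⟩ := exists_ne u
  obtain ⟨r, hr⟩ := hsc u v
  obtain ⟨a, b, hab, rfl, -⟩ := exists_arc_out (fun x => x = u) r u v hr rfl hv
  exact ⟨b, hab⟩

theorem exists_path4 [Fintype V] (hanti : ∀ u v : V, ¬ (A u v ∧ A v u))
    (hsc : StronglyConnected A) (x y z w : V) (hxy : A x y) (hyz : A y z) (hzw : A z w)
    (h4 : 4 ≤ Fintype.card V) :
    ∃ a b c d, A a b ∧ A b c ∧ A c d ∧ [a, b, c, d].Nodup := by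
  have hirr : ∀ x y, A x y → x ≠ y := fun x y h e => hanti _ _ ⟨h, by subst e; exact h⟩
  have h2 : ∀ x y z, A x y → A y z → x ≠ z := fun x y z h h' e => hanti _ _ ⟨h, by subst e; exact h'⟩
  have mk : ∀ a b c d, A a b → A b c → A c d → a ≠ d → [a, b, c, d].Nodup := by
    intro a b c d p q r s
    simp [hirr _ _ p, hirr _ _ q, hirr _ _ r, h2 _ _ _ p q, h2 _ _ _ q r, s]
  by_cases hw : x = w
  · subst hw
    have : ∃ v, v ∉ ({x, y, z} : Finset V) := by
      by_contra hcon
      push Not at hcon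
      have h1 : (Finset.univ : Finset V) ⊆ {x, y, z} := fun v _ => hcon v
      have := (Finset.card_le_card h1).trans Finset.card_le_three
      rw [Finset.card_univ] at this
      omega
    obtain ⟨v, hv⟩ := this
    obtain ⟨r, hr⟩ := hsc x v
    obtain ⟨a, b, hab, ha, hb⟩ := exists_arc_out (fun t => t ∈ ({x, y, z} : Finset V)) r x v hr
      (by simp) hv
    simp only [Finset.mem_insert, Finset.mem_singleton, not_or] at ha hb
    obtain ⟨b1, b2, b3⟩ := hb
    rcases ha with rfl | rfl | rfl
    · exact ⟨y, z, a, b, hyz, hzw, hab, mk _ _ _ _ hyz hzw hab (Ne.symm b2)⟩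
    · exact ⟨z, x, a, b, hzw, hxy, hab, mk _ _ _ _ hzw hxy hab (Ne.symm b3)⟩
    · exact ⟨x, y, a, b, hxy, hyz, hab, mk _ _ _ _ hxy hyz hab (Ne.symm b1)⟩
  · exact ⟨x, y, z, w, hxy, hyz, hzw, mk _ _ _ _ hxy hyz hzw hw⟩

end graph2

theorem stmt19 {V : Type*} [Fintype V] [Nontrivial V] (A : V → V → Prop)
    (hanti : ∀ u v : V, ¬ (A u v ∧ A v u))
    (hsc : StronglyConnected A)
    (hcard : Fintype.card V ≤ 5) :
    (Set.univ : Set V) ∈ lineSet A ∨ Fintype.card V ≤ (lineSet A).ncard := by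
  obtain ⟨x, -, -⟩ := exists_pair_ne V
  obtain ⟨y, hxy⟩ := exists_out hsc x
  obtain ⟨z, hyz⟩ := exists_out hsc y
  obtain ⟨w, hzw⟩ := exists_out hsc z
  have hirr : ∀ x y, A x y → x ≠ y := fun x y h e => hanti _ _ ⟨h, by subst e; exact h⟩
  have hxz : x ≠ z := fun e => hanti _ _ ⟨hxy, by subst e; exact hyz⟩
  by_cases h4 : 4 ≤ Fintype.card V
  · obtain ⟨a, b, c, d, hab, hbc, hcd, hnd⟩ := exists_path4 hanti hsc x y z w hxy hyz hzw h4
    obtain ⟨f, hf, hs, hi⟩ := exists_enum [a, b, c, d] hnd x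
    have f0 : f 0 = a := hf 0 (by simp)
    have f1 : f 1 = b := hf 1 (by simp)
    have f2 : f 2 = c := hf 2 (by simp)
    have f3 : f 3 = d := hf 3 (by simp)
    rw [← f0, ← f1] at hab
    rw [← f1, ← f2] at hbc
    rw [← f2, ← f3] at hcd
    have h45 : Fintype.card V = 4 ∨ Fintype.card V = 5 := by omega
    rcases h45 with h | h <;> rw [h] at hs hi ⊢
    · exact final4 hanti hsc hs hi hab hbc hcd
    · exact final5 hanti hsc hs hi hab hbc hcd
  · have hnd : [x, y, z].Nodup := by simp [hirr _ _ hxy, hirr _ _ hyz, hxz]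
    have h3 : 3 ≤ Fintype.card V := by
      simpa using hnd.length_le_card
    obtain ⟨f, hf, hs, hi⟩ := exists_enum [x, y, z] hnd x
    have f0 : f 0 = x := hf 0 (by simp)
    have f1 : f 1 = y := hf 1 (by simp)
    have f2 : f 2 = z := hf 2 (by simp)
    rw [← f0, ← f1] at hxy
    rw [← f1, ← f2] at hyz
    have h : Fintype.card V = 3 := by omega
    rw [h] at hs hi ⊢
    exact final3 hanti hsc hs hi hxy hyz
end
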